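/- arXiv:2511.12741 — 2 statements merged into one kernel-verified Lean document; each statement's English description precedes it below -/
import Mathlib

section
/- (Caccioppoli-type estimate for the Green's function.) Let Ω = B(0,1) ⊂ ℝⁿ, n ≥ 3, let A be a (λ,Λ)-elliptic coefficient matrix, let B : Ω → ℝⁿ be a measurable drift with δ(x)^{1−β}|B(x)| ≤ M for all x ∈ Ω, and let G be a Green's function of L₁ = −div(A∇·) + B·∇ on Ω. Then there exists a constant K̃ > 0, depending only on n, λ, Λ, M, β, such that for every y ∈ Ω and every 0 < r ≤ δ(y)/2: ∫_{r/2 < |x−y| < r} |∇_x G(y,x)|² dx ≤ K̃ · r^{−2} · ∫_{r/4 < |x−y| < 3r/2} G(y,x)² dx. -/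
open Set Metric MeasureTheory Filter
open scoped RealInnerProductSpace Topology

noncomputable section

/-- Euclidean space `ℝⁿ`. -/
abbrev Euc (n : ℕ) := EuclideanSpace ℝ (Fin n)

/-- A `(λ, Λ)`-elliptic coefficient matrix on the unit ball:
`⟨A(x)η, η⟩ ≥ λ|η|²` and `|⟨A(x)η, ψ⟩| ≤ Λ|η||ψ|` for all `x ∈ Ω`, `η, ψ ∈ ℝⁿ`. -/
def IsElliptic {n : ℕ} (lam Lam : ℝ) (A : Euc n → Euc n →L[ℝ] Euc n) : Prop :=
  ∀ x ∈ ball (0 : Euc n) 1,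
    (∀ η : Euc n, lam * ‖η‖ ^ 2 ≤ ⟪A x η, η⟫) ∧
      ∀ η ψ : Euc n, |⟪A x η, ψ⟫| ≤ Lam * ‖η‖ * ‖ψ‖

/-- The drift bound `δ(x)^(1-β) |B(x)| ≤ M` on the unit ball, where `δ(x) = 1 - |x|`. -/
def DriftBound {n : ℕ} (β M : ℝ) (B : Euc n → Euc n) : Prop :=
  ∀ x ∈ ball (0 : Euc n) 1, (1 - ‖x‖) ^ (1 - β) * ‖B x‖ ≤ M

/-- A Green's function of `L₁ = -div(A∇·) + B·∇` on the unit ball `Ω = B(0,1)`: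
`G > 0` off the diagonal, `G(y, ·)` is `C¹` away from `y` with `G(y,·)` and `|∇ₓG(y,·)|`
locally integrable on `Ω`, and
`∫_Ω (⟨A∇φ, ∇ₓG(y,·)⟩ - G(y,·)⟨B, ∇φ⟩) = φ(y)` for every `φ ∈ C_c^∞(Ω)`, `y ∈ Ω`. -/
def IsGreenFn {n : ℕ} (A : Euc n → Euc n →L[ℝ] Euc n) (B : Euc n → Euc n)
    (G : Euc n → Euc n → ℝ) : Prop :=
  (∀ y ∈ ball (0 : Euc n) 1, ∀ x ∈ ball (0 : Euc n) 1, x ≠ y → 0 < G y x) ∧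
  (∀ y ∈ ball (0 : Euc n) 1, ContDiffOn ℝ 1 (G y) (ball 0 1 \ {y})) ∧
  (∀ y ∈ ball (0 : Euc n) 1, LocallyIntegrableOn (G y) (ball 0 1)) ∧
  (∀ y ∈ ball (0 : Euc n) 1,
    LocallyIntegrableOn (fun x => ‖gradient (G y) x‖) (ball 0 1)) ∧
  (∀ y ∈ ball (0 : Euc n) 1, ∀ φ : Euc n → ℝ,
    ContDiff ℝ (⊤ : ℕ∞) φ → HasCompactSupport φ → tsupport φ ⊆ ball 0 1 →
    (∫ x in ball (0 : Euc n) 1,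
      (⟪A x (gradient φ x), gradient (G y) x⟫ - G y x * ⟪B x, gradient φ x⟫)) = φ y)

open scoped Convolution in
/-- `C¹` functions with compact support are approximated in the `C¹` seminorm by smooth ones
with nearby compact support. -/
theorem exists_contDiff_fderiv_approx {E : Type*} [NormedAddCommGroup E] [InnerProductSpace ℝ E]
    [FiniteDimensional ℝ E] [MeasurableSpace E] [BorelSpace E]
    {φ : E → ℝ} (hφ : ContDiff ℝ 1 φ) (hc : HasCompactSupport φ) {ε : ℝ} (hε : 0 < ε) :
    ∃ ψ : E → ℝ, ContDiff ℝ (⊤ : ℕ∞) ψ ∧ HasCompactSupport ψ ∧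
      tsupport ψ ⊆ cthickening ε (tsupport φ) ∧
      ∀ x, ‖fderiv ℝ ψ x - fderiv ℝ φ x‖ ≤ ε := by
  have hcont : Continuous (fderiv ℝ φ) := hφ.continuous_fderiv (by norm_num)
  have huc : UniformContinuous (fderiv ℝ φ) :=
    (hc.fderiv (𝕜 := ℝ)).uniformContinuous_of_continuous hcont
  obtain ⟨δ, hδ, hδε⟩ := Metric.uniformContinuous_iff.1 huc ε hε
  have hm : 0 < min δ ε := lt_min hδ hε
  let b : ContDiffBump (0 : E) := ⟨min δ ε / 2, min δ ε, by positivity, by linarith⟩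
  let μ : Measure E := volume
  let ψ : E → ℝ := b.normed μ ⋆[ContinuousLinearMap.lsmul ℝ ℝ, μ] φ
  have hbl : LocallyIntegrable (b.normed μ) μ := b.continuous_normed.locallyIntegrable
  have hsub : tsupport ψ ⊆ cthickening ε (tsupport φ) := by
    refine closure_minimal ?_ isClosed_cthickening
    refine (support_convolution_subset _).trans ?_
    rintro _ ⟨z, hz, x, hx, rfl⟩
    rw [b.support_normed_eq] at hz
    refine mem_cthickening_of_dist_le _ x _ _ (subset_tsupport φ hx) ?_
    have h2 : ‖z‖ < min δ ε := mem_ball_zero_iff.1 hz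
    simpa using (h2.le.trans (min_le_right _ _))
  refine ⟨ψ, ?_, ?_, hsub, fun x => ?_⟩
  · exact b.hasCompactSupport_normed.contDiff_convolution_left _ b.contDiff_normed
      hφ.continuous.locallyIntegrable
  · exact b.hasCompactSupport_normed.convolution _ hc
  · have h1 := (hc.hasFDerivAt_convolution_right (ContinuousLinearMap.lsmul ℝ ℝ) hbl hφ x).fderiv
    rw [h1, ← dist_eq_norm]
    exact b.dist_normed_convolution_le (g := fderiv ℝ φ) (x₀ := x)
      hcont.aestronglyMeasurable
      (fun z hz => (hδε (lt_of_lt_of_le hz (min_le_left _ _))).le)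

/-- Cutoff functions on annuli, with the natural gradient bound. -/
theorem exists_annulus_cutoff (n : ℕ) :
    ∃ C > (0 : ℝ), ∀ (y : Euc n) (r : ℝ), 0 < r → ∃ η : Euc n → ℝ,
      ContDiff ℝ (⊤ : ℕ∞) η ∧ (∀ x, 0 ≤ η x ∧ η x ≤ 1) ∧
      (∀ x, r / 2 < ‖x - y‖ → ‖x - y‖ < r → η x = 1) ∧
      tsupport η ⊆ {x | r / 3 ≤ ‖x - y‖ ∧ ‖x - y‖ ≤ 5 * r / 4} ∧
      ∀ x, ‖fderiv ℝ η x‖ ≤ C / r := by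
  let f : ContDiffBump (0 : Euc n) := ⟨1, 5 / 4, by norm_num, by norm_num⟩
  let g : ContDiffBump (0 : Euc n) := ⟨1 / 3, 1 / 2, by norm_num, by norm_num⟩
  let η₀ : Euc n → ℝ := fun z => f z * (1 - g z)
  have hη₀ : ContDiff ℝ (⊤ : ℕ∞) η₀ := f.contDiff.mul (contDiff_const.sub g.contDiff)
  have hc : HasCompactSupport η₀ := f.hasCompactSupport.mul_right
  obtain ⟨C, hC⟩ := (hη₀.continuous_fderiv (by simp)).bounded_above_of_compact_support
    (hc.fderiv (𝕜 := ℝ))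
  have hC0 : 0 ≤ C := (norm_nonneg _).trans (hC 0)
  refine ⟨C + 1, by linarith, fun y r hr => ⟨fun x => η₀ (r⁻¹ • (x - y)), ?_, ?_, ?_, ?_, ?_⟩⟩
  · exact hη₀.comp ((contDiff_id.sub contDiff_const).const_smul r⁻¹)
  · intro x
    have h1 := f.nonneg (x := r⁻¹ • (x - y))
    have h2 := f.le_one (x := r⁻¹ • (x - y))
    have h3 := g.nonneg (x := r⁻¹ • (x - y))
    have h4 := g.le_one (x := r⁻¹ • (x - y))
    exact ⟨mul_nonneg h1 (by linarith), mul_le_one₀ h2 (by linarith) (by linarith)⟩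
  · intro x h1 h2
    have hn : ‖r⁻¹ • (x - y)‖ = ‖x - y‖ / r := by
      rw [norm_smul, norm_inv, Real.norm_of_nonneg hr.le]; ring
    have hf : f (r⁻¹ • (x - y)) = 1 := f.one_of_mem_closedBall (by
      rw [mem_closedBall_zero_iff, hn, div_le_iff₀ hr]; change _ ≤ 1 * r; linarith)
    have hg : g (r⁻¹ • (x - y)) = 0 := g.zero_of_le_dist (by
      rw [dist_zero_right, hn, le_div_iff₀ hr]; change 1 / 2 * r ≤ _; linarith)
    simp [η₀, hf, hg]
  · have hcl : IsClosed {x : Euc n | r / 3 ≤ ‖x - y‖ ∧ ‖x - y‖ ≤ 5 * r / 4} :=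
      isClosed_Icc.preimage (f := fun x : Euc n => ‖x - y‖) (by fun_prop)
    refine closure_minimal (fun x hx => ?_) hcl
    have hn : ‖r⁻¹ • (x - y)‖ = ‖x - y‖ / r := by
      rw [norm_smul, norm_inv, Real.norm_of_nonneg hr.le]; ring
    by_contra hcon
    apply hx
    simp only [mem_ofPred_eq, not_and_or, not_le] at hcon
    rcases hcon with h | h
    · have hg : g (r⁻¹ • (x - y)) = 1 := g.one_of_mem_closedBall (by
        rw [mem_closedBall_zero_iff, hn, div_le_iff₀ hr]; change _ ≤ 1 / 3 * r; linarith)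
      simp [η₀, hg]
    · have hf : f (r⁻¹ • (x - y)) = 0 := f.zero_of_le_dist (by
        rw [dist_zero_right, hn, le_div_iff₀ hr]; change 5 / 4 * r ≤ _; linarith)
      simp [η₀, hf]
  · intro x
    have hd : HasFDerivAt (fun x : Euc n => r⁻¹ • (x - y))
        (r⁻¹ • ContinuousLinearMap.id ℝ (Euc n)) x :=
      ((hasFDerivAt_id x).sub_const y).const_smul r⁻¹
    have hd2 := ((hη₀.differentiable (by simp)) (r⁻¹ • (x - y))).hasFDerivAt.comp x hd
    change ‖fderiv ℝ (η₀ ∘ fun x : Euc n => r⁻¹ • (x - y)) x‖ ≤ _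
    rw [hd2.fderiv, ContinuousLinearMap.comp_smul, ContinuousLinearMap.comp_id, norm_smul,
      norm_inv, Real.norm_of_nonneg hr.le, inv_mul_eq_div]
    gcongr
    linarith [hC (r⁻¹ • (x - y))]

/-- The drift is `O(1/r)` at distance at least `r/2` from the boundary. -/
theorem DriftBound.norm_le {n : ℕ} {β M : ℝ} {B : Euc n → Euc n} (hB : DriftBound β M B)
    (hβ0 : 0 < β) {r : ℝ} (hr : 0 < r) {x : Euc n} (hx : r / 2 ≤ 1 - ‖x‖) :
    ‖B x‖ ≤ 2 * M / r := by
  have hx1 : x ∈ ball (0 : Euc n) 1 := by rw [mem_ball_zero_iff]; linarith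
  have h := hB x hx1
  have hδ1 : 1 - ‖x‖ ≤ 1 := by linarith [norm_nonneg x]
  have hp : r / 2 ≤ (1 - ‖x‖) ^ (1 - β) := hx.trans <| by
    simpa using Real.rpow_le_rpow_of_exponent_ge (by linarith : 0 < 1 - ‖x‖) hδ1
      (by linarith : 1 - β ≤ 1)
  rw [le_div_iff₀ hr]
  nlinarith [mul_le_mul_of_nonneg_right hp (norm_nonneg (B x))]

/-- A first-order functional which is locally bounded near the support of a `C¹` function `φ` and
vanishes on smooth functions supported near that of `φ` also vanishes on `φ`. -/
theorem integral_apply_gradient_eq_zero {E : Type*} [NormedAddCommGroup E] [InnerProductSpace ℝ E]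
    [FiniteDimensional ℝ E] [MeasurableSpace E] [BorelSpace E] (μ : Measure E)
    [IsFiniteMeasureOnCompacts μ] (S : E → E →L[ℝ] ℝ) {φ : E → ℝ} (hφ : ContDiff ℝ 1 φ)
    (hc : HasCompactSupport φ) {ε D : ℝ} (hε : 0 < ε)
    (hD : ∀ x ∈ cthickening ε (tsupport φ), ‖S x‖ ≤ D)
    (hS : ∀ ψ : E → ℝ, ContDiff ℝ (⊤ : ℕ∞) ψ → HasCompactSupport ψ →
      tsupport ψ ⊆ cthickening ε (tsupport φ) →
      Integrable (fun x => S x (gradient ψ x)) μ ∧ ∫ x, S x (gradient ψ x) ∂μ = 0) :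
    Integrable (fun x => S x (gradient φ x)) μ ∧ ∫ x, S x (gradient φ x) ∂μ = 0 := by
  set K := cthickening ε (tsupport φ) with hK
  have hKc : IsCompact K := hc.isCompact.cthickening
  let e : ℕ → ℝ := fun k => ε / (k + 1)
  have he : ∀ k, 0 < e k := fun k => by positivity
  have hle : ∀ k, e k ≤ ε := fun k => div_le_self hε.le (by simp)
  choose ψ hψ hψc hψs hψd using fun k => exists_contDiff_fderiv_approx hφ hc (he k)
  have hψK : ∀ k, tsupport (ψ k) ⊆ K := fun k =>
    (hψs k).trans (cthickening_mono (hle k) _)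
  have hgrad : ∀ k x, ‖gradient (ψ k) x - gradient φ x‖ ≤ e k := fun k x => by
    rw [gradient, gradient, ← map_sub, LinearIsometryEquiv.norm_map]
    exact hψd k x
  obtain ⟨P, hP⟩ := (hφ.continuous_fderiv (by norm_num)).bounded_above_of_compact_support
    (hc.fderiv (𝕜 := ℝ))
  have hP' : ∀ x, ‖gradient φ x‖ ≤ P := fun x => by
    rw [gradient, LinearIsometryEquiv.norm_map]; exact hP x
  have hzero : ∀ f : E → ℝ, tsupport f ⊆ K → ∀ x ∉ K, gradient f x = 0 := fun f hf x hx => by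
    have : fderiv ℝ f x = 0 :=
      image_eq_zero_of_notMem_tsupport (fun h => hx (hf (tsupport_fderiv_subset ℝ h)))
    rw [gradient, this, map_zero]
  have hmem : ∀ k, Integrable (fun x => S x (gradient (ψ k) x)) μ := fun k =>
    (hS _ (hψ k) (hψc k) (hψK k)).1
  have hlim : ∀ x, Tendsto (fun k => S x (gradient (ψ k) x)) atTop (𝓝 (S x (gradient φ x))) := by
    intro x
    refine ((S x).continuous.tendsto _).comp ?_
    rw [tendsto_iff_norm_sub_tendsto_zero]
    refine squeeze_zero (fun _ => norm_nonneg _) (fun k => hgrad k x) ?_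
    have := (tendsto_one_div_add_atTop_nhds_zero_nat (𝕜 := ℝ)).const_mul ε
    simpa [e, div_eq_mul_inv] using this
  have hbound : Integrable (K.indicator fun _ => D * (P + ε)) μ :=
    (integrable_indicator_iff hKc.measurableSet).2 (integrableOn_const hKc.measure_lt_top.ne)
  have hdom : ∀ f : E → ℝ, tsupport f ⊆ K → (∀ x, ‖gradient f x‖ ≤ P + ε) →
      ∀ x, ‖S x (gradient f x)‖ ≤ K.indicator (fun _ => D * (P + ε)) x := by
    intro f hf hfb x
    by_cases hx : x ∈ K
    · rw [indicator_of_mem hx]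
      refine ((S x).le_opNorm _).trans ?_
      exact mul_le_mul (hD x hx) (hfb x) (norm_nonneg _) ((norm_nonneg _).trans (hD x hx))
    · simp [hzero f hf x hx, hx]
  have hmeas : AEStronglyMeasurable (fun x => S x (gradient φ x)) μ :=
    aestronglyMeasurable_of_tendsto_ae atTop (fun k => (hmem k).aestronglyMeasurable)
      (ae_of_all _ hlim)
  refine ⟨hbound.mono' hmeas (ae_of_all _ (hdom φ (self_subset_cthickening _)
    fun x => (hP' x).trans (by linarith))), ?_⟩
  have h := tendsto_integral_of_dominated_convergence _
    (fun k => (hmem k).aestronglyMeasurable) hbound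
    (fun k => ae_of_all _ (hdom (ψ k) (hψK k) fun x => by
      have h1 := norm_sub_norm_le (gradient (ψ k) x) (gradient φ x)
      linarith [hgrad k x, hP' x, hle k])) (ae_of_all _ hlim)
  refine tendsto_nhds_unique h ?_
  simp only [(hS _ (hψ _) (hψc _) (hψK _)).2]
  exact tendsto_const_nhds

/-- The flux functional `v ↦ ⟨A(x)v, ∇ₓG(y,x)⟩ - G(y,x)⟨B(x), v⟩`. -/
def greenFlux {n : ℕ} (A : Euc n → Euc n →L[ℝ] Euc n) (B : Euc n → Euc n)
    (G : Euc n → Euc n → ℝ) (y x : Euc n) : Euc n →L[ℝ] ℝ :=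
  (innerSL ℝ (gradient (G y) x)).comp (A x) - G y x • innerSL ℝ (B x)

theorem greenFlux_apply {n : ℕ} (A : Euc n → Euc n →L[ℝ] Euc n) (B : Euc n → Euc n)
    (G : Euc n → Euc n → ℝ) (y x v : Euc n) :
    greenFlux A B G y x v = ⟪A x v, gradient (G y) x⟫ - G y x * ⟪B x, v⟫ := by
  simp [greenFlux, real_inner_comm]

theorem norm_greenFlux_le {n : ℕ} {lam Lam : ℝ} {A : Euc n → Euc n →L[ℝ] Euc n}
    (hA : IsElliptic lam Lam A) (hLam : 0 ≤ Lam) (B : Euc n → Euc n) (G : Euc n → Euc n → ℝ)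
    (y : Euc n) {x : Euc n} (hx : x ∈ ball (0 : Euc n) 1) :
    ‖greenFlux A B G y x‖ ≤ Lam * ‖gradient (G y) x‖ + |G y x| * ‖B x‖ := by
  refine ContinuousLinearMap.opNorm_le_bound _ (by positivity) fun v => ?_
  rw [greenFlux_apply, Real.norm_eq_abs]
  have h1 := (hA x hx).2 v (gradient (G y) x)
  have h2 := abs_real_inner_le_norm (B x) v
  calc _ ≤ |⟪A x v, gradient (G y) x⟫| + |G y x| * |⟪B x, v⟫| := by
        rw [← abs_mul]; exact abs_sub _ _
    _ ≤ Lam * ‖v‖ * ‖gradient (G y) x‖ + |G y x| * (‖B x‖ * ‖v‖) := by gcongr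
    _ = _ := by ring

/-- The weak formulation implicitly contains the integrability of its integrand: were it not
integrable, the integral would vanish also for test functions with `φ(y) = 1`. -/
theorem IsGreenFn.integrable_greenFlux {n : ℕ} {A : Euc n → Euc n →L[ℝ] Euc n}
    {B : Euc n → Euc n} {G : Euc n → Euc n → ℝ} (hG : IsGreenFn A B G) {y : Euc n}
    (hy : y ∈ ball (0 : Euc n) 1) {φ : Euc n → ℝ} (hφ : ContDiff ℝ (⊤ : ℕ∞) φ)
    (hc : HasCompactSupport φ) (hs : tsupport φ ⊆ ball 0 1) :
    Integrable (fun x => greenFlux A B G y x (gradient φ x))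
      (volume.restrict (ball (0 : Euc n) 1)) := by
  have hweak := hG.2.2.2.2 y hy
  simp only [← greenFlux_apply] at hweak
  have hne : ∀ ψ : Euc n → ℝ, ContDiff ℝ (⊤ : ℕ∞) ψ → HasCompactSupport ψ →
      tsupport ψ ⊆ ball 0 1 → ψ y ≠ 0 →
      Integrable (fun x => greenFlux A B G y x (gradient ψ x))
        (volume.restrict (ball (0 : Euc n) 1)) := by
    intro ψ h1 h2 h3 h4
    by_contra h
    exact h4 (by rw [← hweak ψ h1 h2 h3, integral_undef h])
  by_cases h0 : φ y = 0
  · obtain ⟨ρ, hρ, hρb⟩ := Metric.nhds_basis_closedBall.mem_iff.1 (isOpen_ball.mem_nhds hy)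
    let f : ContDiffBump y := ⟨ρ / 2, ρ, by positivity, by linarith⟩
    have hf1 : f y = 1 := f.one_of_mem_closedBall (mem_closedBall_self f.rIn_pos.le)
    have hfs : tsupport f ⊆ ball 0 1 := by rw [f.tsupport_eq]; exact hρb
    have hsum : tsupport (fun x => φ x + f x) ⊆ ball 0 1 :=
      (tsupport_add φ f).trans (union_subset hs hfs)
    have hi := (hne _ (hφ.add f.contDiff) (hc.add f.hasCompactSupport) hsum
      (by simp [h0, hf1])).sub (hne f f.contDiff f.hasCompactSupport hfs (by simp [hf1]))
    refine hi.congr (ae_of_all _ fun x => ?_)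
    have hd : fderiv ℝ (fun x => φ x + f x) x = fderiv ℝ φ x + fderiv ℝ f x :=
      fderiv_fun_add (hφ.differentiable (by simp) x)
        ((f.contDiff (n := 1)).differentiable (by simp) x)
    simp [gradient, hd]
  · exact hne φ hφ hc hs h0

/-- Absorption of the cross terms in the energy inequality: `e`, `g`, `d`, `b` stand for the cutoff
and for the norms of `∇u`, of the gradient of the cutoff and of the drift. -/
theorem caccioppoli_pointwise {lam Lam e g d b u a p q s c m : ℝ} (hlam : 0 < lam)
    (hLam : 0 ≤ Lam) (he0 : 0 ≤ e) (he1 : e ≤ 1) (hg : 0 ≤ g) (hdc : d ≤ c) (hbm : b ≤ m)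
    (hd : 0 ≤ d) (hb : 0 ≤ b) (ha : lam * g ^ 2 ≤ a) (hp : |p| ≤ Lam * d * g)
    (hq : |q| ≤ b * g) (hs : |s| ≤ b * d) :
    lam / 2 * (e ^ 2 * g ^ 2) - (4 * Lam ^ 2 * c ^ 2 / lam + m ^ 2 / lam + m ^ 2 + c ^ 2) * u ^ 2 ≤
      e ^ 2 * a + 2 * e * u * p - u * (e ^ 2 * q + 2 * e * u * s) := by
  have hm : 0 ≤ m := hb.trans hbm
  have hc : 0 ≤ c := hd.trans hdc
  have hp' : |p| ≤ Lam * c * g := hp.trans (by gcongr)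
  have hq' : |q| ≤ m * g := hq.trans (by gcongr)
  have hs' : |s| ≤ m * c := hs.trans (by gcongr)
  have h1 : -(2 * e * |u| * (Lam * c * g)) ≤ 2 * e * u * p := by
    refine (neg_le_neg ?_).trans (neg_abs_le (2 * e * u * p))
    rw [abs_mul, abs_mul, abs_of_nonneg (by positivity : 0 ≤ 2 * e)]
    gcongr
  have h2 : u * (e ^ 2 * q) ≤ |u| * (e ^ 2 * (m * g)) := by
    refine (le_abs_self _).trans ?_
    rw [abs_mul, abs_mul, abs_of_nonneg (sq_nonneg e)]
    gcongr
  have h3 : u * (2 * e * u * s) ≤ 2 * u ^ 2 * (m * c) := by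
    have hes : e * s ≤ m * c := calc
      e * s ≤ e * |s| := by gcongr; exact le_abs_self s
      _ ≤ 1 * (m * c) := by gcongr
      _ = m * c := one_mul _
    calc u * (2 * e * u * s) = 2 * u ^ 2 * (e * s) := by ring
      _ ≤ 2 * u ^ 2 * (m * c) := mul_le_mul_of_nonneg_left hes (by positivity)
  have h4 : 2 * e * |u| * (Lam * c * g) ≤
      lam / 4 * (e ^ 2 * g ^ 2) + 4 * Lam ^ 2 * c ^ 2 / lam * u ^ 2 := by
    have : 0 ≤ (lam / 2 * (e * g) - 2 * Lam * c * |u|) ^ 2 / lam := by positivity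
    rw [← sq_abs u]
    calc _ ≤ 2 * e * |u| * (Lam * c * g) +
          (lam / 2 * (e * g) - 2 * Lam * c * |u|) ^ 2 / lam := by linarith
      _ = _ := by field_simp; ring
  have h5 : |u| * (e ^ 2 * (m * g)) ≤ lam / 4 * (e ^ 2 * g ^ 2) + m ^ 2 / lam * u ^ 2 := by
    have : 0 ≤ (lam / 2 * (e * g) - m * |u|) ^ 2 / lam := by positivity
    rw [← sq_abs u]
    calc |u| * (e ^ 2 * (m * g)) = e * (|u| * e * m * g) := by ring
      _ ≤ 1 * (|u| * e * m * g) := by gcongr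
      _ ≤ |u| * e * m * g + (lam / 2 * (e * g) - m * |u|) ^ 2 / lam := by linarith
      _ = _ := by field_simp; ring
  have h6 : 2 * u ^ 2 * (m * c) ≤ (m ^ 2 + c ^ 2) * u ^ 2 := by
    nlinarith [mul_nonneg (sq_nonneg (m - c)) (sq_nonneg u)]
  have h7 := mul_le_mul_of_nonneg_left ha (sq_nonneg e)
  linarith

/-- Caccioppoli-type estimate for the Green's function:
`∫_{r/2<|x-y|<r} |∇ₓG(y,x)|² dx ≤ K̃ r⁻² ∫_{r/4<|x-y|<3r/2} G(y,x)² dx`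
for `0 < r ≤ δ(y)/2`, with `K̃` depending only on `n`, `λ`, `Λ`, `M`, `β`. -/
theorem green_caccioppoli
    (n : ℕ) (hn : 3 ≤ n) (β M lam Lam : ℝ)
    (hβ0 : 0 < β) (hβ1 : β < 1) (hM : 0 < M) (hlam : 0 < lam) (hLam : lam ≤ Lam) :
    ∃ K > (0 : ℝ), ∀ (A : Euc n → Euc n →L[ℝ] Euc n) (B : Euc n → Euc n)
      (G : Euc n → Euc n → ℝ),
      IsElliptic lam Lam A → Measurable B → DriftBound β M B → IsGreenFn A B G →
      ∀ y ∈ ball (0 : Euc n) 1, ∀ r : ℝ, 0 < r → r ≤ (1 - ‖y‖) / 2 →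
        (∫ x in {x : Euc n | r / 2 < ‖x - y‖ ∧ ‖x - y‖ < r},
            ‖gradient (G y) x‖ ^ 2) ≤
          K / r ^ 2 *
            ∫ x in {x : Euc n | r / 4 < ‖x - y‖ ∧ ‖x - y‖ < 3 * r / 2}, (G y x) ^ 2 := by
  have hLam0 : 0 ≤ Lam := hlam.le.trans hLam
  obtain ⟨C, hC, hcut⟩ := exists_annulus_cutoff n
  set R : ℝ := 4 * Lam ^ 2 * C ^ 2 / lam + (2 * M) ^ 2 / lam + (2 * M) ^ 2 + C ^ 2 with hR
  have hR0 : 0 < R := by positivity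
  refine ⟨2 * R / lam, by positivity, fun A B G hA _ hB hG y hy r hr hry => ?_⟩
  obtain ⟨η, hη, hη01, hη1, hηs, hηd⟩ := hcut y r hr
  set u := G y with hu
  let K : Set (Euc n) := {x | r / 4 ≤ ‖x - y‖ ∧ ‖x - y‖ ≤ 3 * r / 2}
  have hKcl : IsClosed K := isClosed_Icc.preimage (f := fun x : Euc n => ‖x - y‖) (by fun_prop)
  have hKc : IsCompact K := (isCompact_closedBall y (3 * r / 2)).of_isClosed_subset hKcl
    fun x hx => mem_closedBall_iff_norm.2 hx.2
  have hKδ : ∀ x ∈ K, r / 2 ≤ 1 - ‖x‖ := fun x hx => by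
    have h1 : ‖x‖ ≤ ‖x - y‖ + ‖y‖ := by simpa using norm_add_le (x - y) y
    linarith [hx.2]
  have hKb : K ⊆ ball 0 1 \ {y} := fun x hx => by
    refine ⟨mem_ball_zero_iff.2 (by linarith [hKδ x hx]), fun h => ?_⟩
    have h1 := hx.1
    rw [mem_singleton_iff.1 h, sub_self, norm_zero] at h1
    linarith
  have hKball : K ⊆ ball 0 1 := hKb.trans sdiff_subset
  have hBK : ∀ x ∈ K, ‖B x‖ ≤ 2 * M / r := fun x hx => hB.norm_le hβ0 hr (hKδ x hx)
  have hopen : IsOpen (ball (0 : Euc n) 1 \ {y}) := isOpen_ball.sdiff isClosed_singleton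
  have hud : ContDiffOn ℝ 1 u (ball 0 1 \ {y}) := hG.2.1 y hy
  have huc : ContinuousOn u K := hud.continuousOn.mono hKb
  have hgc : ContinuousOn (gradient u) K :=
    ((InnerProductSpace.toDual ℝ (Euc n)).symm.continuous.comp_continuousOn
      (hud.continuousOn_fderiv_of_isOpen hopen le_rfl)).mono hKb
  have hηK : tsupport η ⊆ K := fun x hx => by
    have := hηs hx
    exact ⟨by linarith [this.1], by linarith [this.2]⟩
  let φ : Euc n → ℝ := fun x => η x ^ 2 * u x
  have hφη : tsupport φ ⊆ tsupport η := closure_mono fun x hx hx0 => hx (by simp [φ, hx0])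
  have hφd : ContDiff ℝ 1 φ := contDiff_iff_contDiffAt.2 fun x => by
    by_cases hx : x ∈ tsupport φ
    · exact ((hη.of_le (by simp)).contDiffAt.pow 2).mul
        (hud.contDiffAt (hopen.mem_nhds (hKb (hηK (hφη hx)))))
    · exact contDiffAt_const.congr_of_eventuallyEq (notMem_tsupport_iff_eventuallyEq.1 hx)
  have hφc : HasCompactSupport φ :=
    hKc.of_isClosed_subset (isClosed_tsupport _) (hφη.trans hηK)
  have hthick : cthickening (r / 24) (tsupport φ) ⊆ K := by
    rw [cthickening_eq_biUnion_closedBall _ (by positivity)]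
    refine iUnion₂_subset fun z hz x hx => ?_
    have h1 := hηs (hφη ((isClosed_tsupport φ).closure_eq ▸ hz))
    have h2 : ‖x - z‖ ≤ r / 24 := mem_closedBall_iff_norm.1 hx
    have h3 : ‖x - y‖ ≤ ‖x - z‖ + ‖z - y‖ := norm_sub_le_norm_sub_add_norm_sub x z y
    have h4 : ‖z - y‖ ≤ ‖x - z‖ + ‖x - y‖ := by
      rw [norm_sub_rev x z]; exact norm_sub_le_norm_sub_add_norm_sub z x y
    exact ⟨by linarith [h1.1], by linarith [h1.2]⟩
  obtain ⟨D₁, hD₁⟩ := hKc.exists_bound_of_continuousOn hgc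
  obtain ⟨D₂, hD₂⟩ := hKc.exists_bound_of_continuousOn huc
  obtain ⟨hint, hzero⟩ := integral_apply_gradient_eq_zero
    (volume.restrict (ball (0 : Euc n) 1)) (greenFlux A B G y) hφd hφc
    (ε := r / 24) (D := Lam * D₁ + D₂ * (2 * M / r)) (by positivity)
    (fun x hx => by
      have hxK := hthick hx
      refine (norm_greenFlux_le hA hLam0 B G y (hKball hxK)).trans ?_
      have h2 : |G y x| ≤ D₂ := hD₂ x hxK
      have h1 := hD₁ x hxK
      exact add_le_add (mul_le_mul_of_nonneg_left h1 hLam0)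
        (mul_le_mul h2 (hBK x hxK) (norm_nonneg _) ((abs_nonneg _).trans h2)))
    (fun ψ h1 h2 h3 => by
      have h4 := (h3.trans hthick).trans hKball
      refine ⟨hG.integrable_greenFlux hy h1 h2 h4, ?_⟩
      simp only [greenFlux_apply]
      rw [hG.2.2.2.2 y hy ψ h1 h2 h4]
      exact image_eq_zero_of_notMem_tsupport fun h => (hKb (hthick (h3 h))).2 rfl)
  set S : Set (Euc n) := {x | r / 2 < ‖x - y‖ ∧ ‖x - y‖ < r} with hSdef
  set T : Set (Euc n) := {x | r / 4 < ‖x - y‖ ∧ ‖x - y‖ < 3 * r / 2} with hTdef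
  have hSm : MeasurableSet S :=
    (isOpen_Ioo.preimage (f := fun x : Euc n => ‖x - y‖) (by fun_prop)).measurableSet
  have hTm : MeasurableSet T :=
    (isOpen_Ioo.preimage (f := fun x : Euc n => ‖x - y‖) (by fun_prop)).measurableSet
  have hSK : S ⊆ K := fun x hx => ⟨by linarith [hx.1], by linarith [hx.2]⟩
  have hTK : T ⊆ K := fun x hx => ⟨hx.1.le, hx.2.le⟩
  have hpt : ∀ x ∈ ball (0 : Euc n) 1,
      lam / 2 * S.indicator (fun x => ‖gradient u x‖ ^ 2) x -
        R / r ^ 2 * T.indicator (fun x => u x ^ 2) x ≤ greenFlux A B G y x (gradient φ x) := by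
    intro x hx
    by_cases hxs : x ∈ tsupport η
    · have hxK := hηK hxs
      have hxT : x ∈ T := by
        have := hηs hxs
        exact ⟨by linarith [this.1], by linarith [this.2]⟩
      have hgφ : gradient φ x = η x ^ 2 • gradient u x + (2 * η x * u x) • gradient η x := by
        have h1 := (hη.differentiable (by simp) x).hasFDerivAt
        have h2 := ((hud.contDiffAt (hopen.mem_nhds (hKb hxK))).differentiableAt
          (by norm_num)).hasFDerivAt
        have h3 : fderiv ℝ φ x = _ := ((h1.pow 2).mul h2).fderiv
        rw [gradient, h3]
        simp [gradient, smul_smul]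
        ring_nf
      have hgη : ‖gradient η x‖ ≤ C / r := by
        rw [gradient, LinearIsometryEquiv.norm_map]; exact hηd x
      have key := caccioppoli_pointwise (u := u x) hlam hLam0 (hη01 x).1 (hη01 x).2
        (norm_nonneg (gradient u x)) hgη (hBK x hxK) (norm_nonneg _) (norm_nonneg _)
        ((hA x hx).1 (gradient u x)) ((hA x hx).2 (gradient η x) (gradient u x))
        (abs_real_inner_le_norm (B x) (gradient u x))
        (abs_real_inner_le_norm (B x) (gradient η x))
      have hRr : R / r ^ 2 = 4 * Lam ^ 2 * (C / r) ^ 2 / lam + (2 * M / r) ^ 2 / lam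
          + (2 * M / r) ^ 2 + (C / r) ^ 2 := by
        rw [hR]; field_simp
      have hSle : S.indicator (fun x => ‖gradient u x‖ ^ 2) x ≤ η x ^ 2 * ‖gradient u x‖ ^ 2 := by
        by_cases hxS : x ∈ S
        · simp [hxS, hη1 x hxS.1 hxS.2]
        · simp only [indicator_of_notMem hxS]; positivity
      have hSle' := mul_le_mul_of_nonneg_left hSle (by positivity : 0 ≤ lam / 2)
      rw [indicator_of_mem hxT, greenFlux_apply, hgφ, hRr]
      simp only [map_add, map_smul, inner_add_left, inner_add_right, real_inner_smul_left,
        real_inner_smul_right]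
      rw [← hu]
      linarith
    · have hxS : x ∉ S := fun h => hxs (subset_tsupport η (by
        rw [Function.mem_support, hη1 x h.1 h.2]; exact one_ne_zero))
      have h0 : fderiv ℝ φ x = 0 := image_eq_zero_of_notMem_tsupport
        fun h => hxs (hφη (tsupport_fderiv_subset ℝ h))
      have hg0 : gradient φ x = 0 := by rw [gradient, h0, map_zero]
      rw [hg0, map_zero, indicator_of_notMem hxS]
      have := indicator_nonneg (s := T) (f := fun x => u x ^ 2) (fun x _ => sq_nonneg _) x
      have := mul_nonneg (by positivity : 0 ≤ R / r ^ 2) this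
      linarith
  have hSi : Integrable (S.indicator fun x => ‖gradient u x‖ ^ 2)
      (volume.restrict (ball (0 : Euc n) 1)) :=
    ((integrable_indicator_iff hSm).2
      (((hgc.norm.pow 2).integrableOn_compact hKc).mono_set hSK)).restrict
  have hTi : Integrable (T.indicator fun x => u x ^ 2)
      (volume.restrict (ball (0 : Euc n) 1)) :=
    ((integrable_indicator_iff hTm).2
      (((huc.pow 2).integrableOn_compact hKc).mono_set hTK)).restrict
  have hmono := integral_mono_ae ((hSi.const_mul (lam / 2)).sub (hTi.const_mul (R / r ^ 2))) hint
    ((ae_restrict_iff' measurableSet_ball).2 (ae_of_all _ hpt))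
  simp only [Pi.sub_apply] at hmono
  rw [hzero, integral_sub (hSi.const_mul _) (hTi.const_mul _), integral_const_mul,
    integral_const_mul, setIntegral_indicator hSm, setIntegral_indicator hTm,
    inter_eq_right.2 (hSK.trans hKball), inter_eq_right.2 (hTK.trans hKball)] at hmono
  have hfin := mul_le_mul_of_nonneg_left (sub_nonpos.1 hmono) (by positivity : 0 ≤ 2 / lam)
  calc _ = 2 / lam * (lam / 2 * ∫ x in S, ‖gradient u x‖ ^ 2) := by field_simp
    _ ≤ _ := hfin
    _ = _ := by ring
end
end

section
/- (Level-set decay inequality.) Let Ω = B(0,1) ⊂ ℝⁿ, n ≥ 3, let B be an admissible drift, let g be a Green's function of L = −Δ + B·∇ on Ω with pole at 0, and for s > 0 set Ω_s = { x ∈ Ω : g(x) ≥ s }. Then there exist constants K₁, K₂ > 0, depending only on n, such that for every s > 0: |Ω_{2s}|^{(n−2)/n} ≤ K₁/s + K₂ · ( ∫_{Ω_s} |B(x)|ⁿ dx )^{2/n} · |Ω_s|^{(n−2)/n}, where |·| denotes Lebesgue measure. -/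
open Set Metric MeasureTheory Filter
open scoped RealInnerProductSpace Topology

noncomputable section

/-- The divergence `div B x = ∑ i ∂ᵢ Bᵢ (x)` of a vector field. -/
def divg {n : ℕ} (B : Euc n → Euc n) (x : Euc n) : ℝ :=
  ∑ i : Fin n, ⟪fderiv ℝ B x (EuclideanSpace.single i 1), EuclideanSpace.single i (1 : ℝ)⟫

/-- An admissible drift on the unit ball `Ω = B(0,1)`: `B` is continuously differentiable on
`Ω`, `δ(x)^(1-β) |B(x)| ≤ M` on `Ω` (where `δ(x) = 1 - |x|`), and
`-M δ(x)^(β-2) ≤ div B(x) ≤ 0` on `Ω`. -/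
def AdmissibleDrift {n : ℕ} (β M : ℝ) (B : Euc n → Euc n) : Prop :=
  ContDiffOn ℝ 1 B (ball 0 1) ∧
  (∀ x ∈ ball (0 : Euc n) 1, (1 - ‖x‖) ^ (1 - β) * ‖B x‖ ≤ M) ∧
  (∀ x ∈ ball (0 : Euc n) 1, -(M * (1 - ‖x‖) ^ (β - 2)) ≤ divg B x ∧ divg B x ≤ 0)

/-- A Green's function of `L = -Δ + B·∇` on the unit ball `Ω = B(0,1)` with pole at `y`:
positive on `Ω \ {y}`, three times continuously differentiable there, `g` and `|∇g|`
integrable on `Ω`, `g(x) → 0` as `|x| → 1`, and the weak formulation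
`∫_Ω (⟨∇g, ∇φ⟩ + ⟨B, ∇g⟩ φ) = φ(y)` for every test function `φ ∈ C_c^∞(Ω)`. -/
def IsGreenPole {n : ℕ} (B : Euc n → Euc n) (y : Euc n) (g : Euc n → ℝ) : Prop :=
  (∀ x ∈ ball (0 : Euc n) 1, x ≠ y → 0 < g x) ∧
  ContDiffOn ℝ 3 g (ball 0 1 \ {y}) ∧
  IntegrableOn g (ball 0 1) ∧
  IntegrableOn (fun x => ‖gradient g x‖) (ball 0 1) ∧
  (∀ ε > 0, ∃ t < (1 : ℝ), ∀ x ∈ ball (0 : Euc n) 1, t < ‖x‖ → |g x| < ε) ∧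
  (∀ φ : Euc n → ℝ, ContDiff ℝ (⊤ : ℕ∞) φ → HasCompactSupport φ → tsupport φ ⊆ ball 0 1 →
    (∫ x in ball (0 : Euc n) 1,
      (⟪gradient g x, gradient φ x⟫ + ⟪B x, gradient g x⟫ * φ x)) = φ y)


/-- The super-level set `Ω_s = {x ∈ Ω \ {0} : g(x) ≥ s}`. -/
def levelSet {n : ℕ} (g : Euc n → ℝ) (s : ℝ) : Set (Euc n) :=
  {x : Euc n | x ∈ ball (0 : Euc n) 1 ∧ x ≠ 0 ∧ s ≤ g x}


lemma contDiff_of_forall_mem_tsupport {E F : Type*} [NormedAddCommGroup E] [NormedSpace ℝ E]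
    [NormedAddCommGroup F] [NormedSpace ℝ F] {f : E → F} {m : WithTop ℕ∞}
    (hf : ∀ x ∈ tsupport f, ContDiffAt ℝ m f x) : ContDiff ℝ m f := by
  refine contDiff_iff_contDiffAt.2 fun x => ?_
  by_cases hx : x ∈ tsupport f
  · exact hf x hx
  · exact contDiffAt_const.congr_of_eventuallyEq (notMem_tsupport_iff_eventuallyEq.1 hx)

/-- The integral of a directional derivative of a compactly supported `C¹` function vanishes. -/
lemma integral_fderiv_apply_eq_zero {n : ℕ} {w : Euc n → ℝ} (hw : ContDiff ℝ 1 w)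
    (hc : HasCompactSupport w) (v : Euc n) : ∫ x, fderiv ℝ w x v = 0 := by
  have hcont : Continuous fun x => fderiv ℝ w x v :=
    (hw.continuous_fderiv one_ne_zero).clm_apply continuous_const
  have h := integral_smul_fderiv_eq_neg_fderiv_smul_of_integrable (μ := volume) (𝕜 := ℝ)
    (f := fun _ : Euc n => (1 : ℝ)) (g := w) (v := v) (by simp)
    (by simpa using hcont.integrable_of_hasCompactSupport (hc.fderiv_apply ℝ v))
    (by simpa using hw.continuous.integrable_of_hasCompactSupport hc)
    (fun x _ => differentiableAt_const _)
    (fun x _ => hw.differentiable one_ne_zero x)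
  simpa using h

lemma continuousOn_gradient {n : ℕ} {g : Euc n → ℝ} {U : Set (Euc n)} (hU : IsOpen U)
    (hg : ContDiffOn ℝ 1 g U) : ContinuousOn (gradient g) U :=
  (InnerProductSpace.toDual ℝ (Euc n)).symm.continuous.comp_continuousOn
    (hg.continuousOn_fderiv_of_isOpen hU le_rfl)

lemma continuous_gradient {n : ℕ} {g : Euc n → ℝ} (hg : ContDiff ℝ 1 g) :
    Continuous (gradient g) :=
  (InnerProductSpace.toDual ℝ (Euc n)).symm.continuous.comp (hg.continuous_fderiv one_ne_zero)

lemma norm_gradient {n : ℕ} (g : Euc n → ℝ) (x : Euc n) : ‖gradient g x‖ = ‖fderiv ℝ g x‖ :=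
  (InnerProductSpace.toDual ℝ (Euc n)).symm.norm_map _

lemma gradient_eq_zero_of_notMem_tsupport {n : ℕ} {g : Euc n → ℝ} {x : Euc n}
    (hx : x ∉ tsupport g) : gradient g x = 0 := by
  rw [gradient, show fderiv ℝ g x = 0 from
    image_eq_zero_of_notMem_tsupport fun h => hx (tsupport_fderiv_subset ℝ h), map_zero]

/-- A quadratic form vanishing exactly on the line spanned by `v`; it measures the distance to
that line. -/
def lineForm {n : ℕ} (v y : Euc n) : ℝ := ‖v‖ ^ 2 * ‖y‖ ^ 2 - ⟪v, y⟫ ^ 2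

lemma contDiff_lineForm {n : ℕ} (v : Euc n) {m : WithTop ℕ∞} : ContDiff ℝ m (lineForm v) := by
  unfold lineForm
  exact (contDiff_const.mul (contDiff_norm_sq ℝ)).sub ((contDiff_const.inner ℝ contDiff_id).pow 2)

lemma fderiv_lineForm_apply_self {n : ℕ} (v y : Euc n) : fderiv ℝ (lineForm v) y v = 0 := by
  have h1 : HasFDerivAt (fun y : Euc n => ‖y‖ ^ 2) (2 • (innerSL ℝ y)) y :=
    (hasStrictFDerivAt_norm_sq y).hasFDerivAt
  have h2 : HasFDerivAt (fun y : Euc n => ⟪v, y⟫) (innerSL ℝ v) y := (innerSL ℝ v).hasFDerivAt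
  have h3 := (h1.const_mul (‖v‖ ^ 2)).sub (h2.pow 2)
  have h4 : HasFDerivAt (lineForm v) _ y := h3
  rw [h4.fderiv]
  simp [real_inner_comm v y]
  ring

lemma lineForm_zero {n : ℕ} (v : Euc n) : lineForm v 0 = 0 := by simp [lineForm]

lemma ae_lineForm_pos {n : ℕ} (hn : 2 ≤ n) {v : Euc n} (hv : v ≠ 0) :
    ∀ᵐ y : Euc n, 0 < lineForm v y := by
  have hspan : (volume : Measure (Euc n)) (Submodule.span ℝ {v} : Submodule ℝ (Euc n)) = 0 := by
    refine Measure.addHaar_submodule _ _ fun h => ?_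
    have h1 := finrank_span_singleton (K := ℝ) hv
    rw [h, finrank_top, finrank_euclideanSpace_fin] at h1
    omega
  refine measure_mono_null (fun y hy => ?_) hspan
  have hy' : lineForm v y ≤ 0 := not_lt.1 hy
  have h1 : (‖v‖ * ‖y‖) ^ 2 ≤ |⟪v, y⟫| ^ 2 := by
    rw [sq_abs, mul_pow]; unfold lineForm at hy'; linarith
  have h2 : ‖v‖ * ‖y‖ ≤ |⟪v, y⟫| := le_of_sq_le_sq h1 (abs_nonneg _)
  have h3 : ‖⟪v, y⟫‖ = ‖v‖ * ‖y‖ := le_antisymm (norm_inner_le_norm v y) h2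
  rcases eq_or_ne y 0 with rfl | hy0
  · exact Submodule.zero_mem _
  · obtain ⟨r, -, hr⟩ := (norm_inner_eq_norm_iff hv hy0).1 h3
    exact Submodule.mem_span_singleton.2 ⟨r, hr.symm⟩

/-- A smooth cutoff vanishing near the line spanned by `v`, converging to `1` off that line as
`j → ∞`, and constant in the direction `v`. -/
def lineCutoff {n : ℕ} (v : Euc n) (j : ℕ) (y : Euc n) : ℝ :=
  Real.smoothTransition (j * lineForm v y - 1)

lemma contDiff_lineCutoff {n : ℕ} (v : Euc n) (j : ℕ) {m : ℕ∞} :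
    ContDiff ℝ m (lineCutoff v j) :=
  Real.smoothTransition.contDiff.comp ((contDiff_const.mul (contDiff_lineForm v)).sub contDiff_const)

lemma fderiv_lineCutoff_apply_self {n : ℕ} (v : Euc n) (j : ℕ) (y : Euc n) :
    fderiv ℝ (lineCutoff v j) y v = 0 := by
  have h1 : HasFDerivAt (fun y => (j : ℝ) * lineForm v y - 1)
      ((j : ℝ) • fderiv ℝ (lineForm v) y) y :=
    ((((contDiff_lineForm v (m := 1)).differentiable one_ne_zero y).hasFDerivAt).const_mul
      (j : ℝ)).sub_const 1
  have h2 := (((Real.smoothTransition.contDiff (n := 1)).differentiable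
    (by norm_num)) ((j : ℝ) * lineForm v y - 1)).hasDerivAt
  have h3 : HasFDerivAt (lineCutoff v j) _ y := h2.comp_hasFDerivAt y h1
  rw [h3.fderiv]
  simp [fderiv_lineForm_apply_self]

lemma lineCutoff_eventuallyEq_zero {n : ℕ} {v y : Euc n} {j : ℕ} (hy : j * lineForm v y < 1) :
    lineCutoff v j =ᶠ[𝓝 y] 0 := by
  have hc : Continuous fun y => (j : ℝ) * lineForm v y :=
    continuous_const.mul (contDiff_lineForm v (m := 0)).continuous
  filter_upwards [hc.continuousAt.eventually_lt continuousAt_const hy] with z hz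
  exact Real.smoothTransition.zero_of_nonpos (by linarith)

lemma lineCutoff_tendsto_one {n : ℕ} {v y : Euc n} (hy : 0 < lineForm v y) :
    Tendsto (fun j => lineCutoff v j y) atTop (𝓝 1) := by
  refine tendsto_const_nhds.congr' ?_
  have h : Tendsto (fun j : ℕ => (j : ℝ) * lineForm v y) atTop atTop :=
    tendsto_natCast_atTop_atTop.atTop_mul_const hy
  filter_upwards [h.eventually_ge_atTop 2] with j hj
  exact (Real.smoothTransition.one_of_one_le (by linarith)).symm

lemma integrableOn_gradient {n : ℕ} (hn : 2 ≤ n) {U : Set (Euc n)} (hU : IsOpen U)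
    {g : Euc n → ℝ} (hg : ContDiffOn ℝ 1 g (U \ {0}))
    (hi : IntegrableOn (fun x => ‖gradient g x‖) U) : IntegrableOn (gradient g) U := by
  have : Nontrivial (Euc n) := by
    have : Nonempty (Fin n) := ⟨⟨0, by omega⟩⟩
    infer_instance
  have hU' : IsOpen (U \ {0}) := hU.sdiff isClosed_singleton
  have hae : (U \ {0} : Set (Euc n)) =ᵐ[volume] U := sdiff_null_ae_eq_self (measure_singleton 0)
  refine ⟨?_, hi.norm.2.mono (Eventually.of_forall fun x => by simp)⟩
  rw [← Measure.restrict_congr_set hae]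
  exact (continuousOn_gradient hU' hg).aestronglyMeasurable hU'.measurableSet

/-- Integration by parts across an isolated singularity in dimension at least two. -/
lemma setIntegral_mul_fderiv_eq_neg {n : ℕ} (hn : 2 ≤ n) {U : Set (Euc n)} (hU : IsOpen U)
    {g : Euc n → ℝ} (hg : ContDiffOn ℝ 1 g (U \ {0})) (hgi : IntegrableOn g U)
    (hdi : IntegrableOn (fun x => ‖gradient g x‖) U)
    {ψ : Euc n → ℝ} (hψ : ContDiff ℝ 1 ψ) (hc : HasCompactSupport ψ) (hs : tsupport ψ ⊆ U)
    (v : Euc n) :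
    ∫ y in U, g y * fderiv ℝ ψ y v = - ∫ y in U, ⟪gradient g y, v⟫ * ψ y := by
  rcases eq_or_ne v 0 with rfl | hv
  · simp
  have hU' : IsOpen (U \ {0}) := hU.sdiff isClosed_singleton
  have hgrad := integrableOn_gradient hn hU hg hdi
  obtain ⟨C₁, hC₁⟩ := hc.exists_bound_of_continuous hψ.continuous
  have hψ' : Continuous fun y => fderiv ℝ ψ y v :=
    (hψ.continuous_fderiv one_ne_zero).clm_apply continuous_const
  obtain ⟨C₂, hC₂⟩ := (hc.fderiv_apply ℝ v).exists_bound_of_continuous hψ'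
  have hI₁ : IntegrableOn (fun y => g y * fderiv ℝ ψ y v) U :=
    Integrable.mul_bdd hgi hψ'.aestronglyMeasurable (Eventually.of_forall hC₂)
  have hI₂ : IntegrableOn (fun y => ⟪gradient g y, v⟫ * ψ y) U :=
    Integrable.mul_bdd (hgrad.inner_const v) hψ.continuous.aestronglyMeasurable
      (Eventually.of_forall hC₁)
  rw [eq_neg_iff_add_eq_zero, ← integral_add hI₁ hI₂]
  have hzero : ∀ j : ℕ, ∫ y in U, lineCutoff v j y *
      (g y * fderiv ℝ ψ y v + ⟪gradient g y, v⟫ * ψ y) = 0 := by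
    intro j
    set w : Euc n → ℝ := fun y => lineCutoff v j y * (g y * ψ y) with hw
    have hsup : tsupport w ⊆ tsupport ψ := by
      refine closure_mono fun y hy => ?_
      simp only [hw, Function.mem_support, ne_eq, mul_eq_zero, not_or] at hy
      exact hy.2.2
    have hreg : ∀ y ∈ U, ¬ (j * lineForm v y < 1) → ContDiffAt ℝ 1 g y := by
      intro y hy hj
      refine hg.contDiffAt (hU'.mem_nhds ⟨hy, ?_⟩)
      rintro rfl
      exact hj (by simp [lineForm_zero])
    have hwz : ∀ y, j * lineForm v y < 1 → w =ᶠ[𝓝 y] fun _ => 0 := fun y hj => by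
      filter_upwards [lineCutoff_eventuallyEq_zero hj] with z hz
      simp [hw, hz]
    have hwC : ContDiff ℝ 1 w := by
      refine contDiff_of_forall_mem_tsupport fun y hy => ?_
      by_cases hj : j * lineForm v y < 1
      · exact contDiffAt_const.congr_of_eventuallyEq (hwz y hj)
      · exact (contDiff_lineCutoff v j (m := 1)).contDiffAt.mul
          ((hreg y (hs (hsup hy)) hj).mul hψ.contDiffAt)
    have hwc : HasCompactSupport w := hc.of_isClosed_subset (isClosed_tsupport _) hsup
    rw [← integral_fderiv_apply_eq_zero hwC hwc v, ← setIntegral_eq_integral_of_forall_compl_eq_zero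
      (s := U) (f := fun y => fderiv ℝ w y v)]
    · refine setIntegral_congr_fun hU.measurableSet fun y hy => ?_
      by_cases hj : j * lineForm v y < 1
      · simp [(hwz y hj).fderiv_eq, (lineCutoff_eventuallyEq_zero hj).eq_of_nhds]
      · have h1 := ((contDiff_lineCutoff v j (m := 1)).differentiable (by norm_num) y).hasFDerivAt
        have h2 := ((hreg y hy hj).differentiableAt one_ne_zero).hasFDerivAt
        have h3 := (hψ.differentiable one_ne_zero y).hasFDerivAt
        have h4 : HasFDerivAt w _ y := h1.mul (h2.mul h3)
        simp only [h4.fderiv, inner_gradient_left]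
        simp [fderiv_lineCutoff_apply_self]
        ring
    · intro y hy
      have : y ∉ tsupport (fderiv ℝ w) := fun h => hy (hs (hsup (tsupport_fderiv_subset ℝ h)))
      simp [image_eq_zero_of_notMem_tsupport this]
  have hlim : Tendsto (fun j : ℕ => ∫ y in U, lineCutoff v j y *
      (g y * fderiv ℝ ψ y v + ⟪gradient g y, v⟫ * ψ y)) atTop
      (𝓝 (∫ y in U, (g y * fderiv ℝ ψ y v + ⟪gradient g y, v⟫ * ψ y))) := by
    refine tendsto_integral_of_dominated_convergence
      (fun y => ‖g y * fderiv ℝ ψ y v + ⟪gradient g y, v⟫ * ψ y‖) (fun j => ?_) (hI₁.add hI₂).norm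
      (fun j => Eventually.of_forall fun y => ?_) ?_
    · exact (contDiff_lineCutoff v j (m := 0)).continuous.aestronglyMeasurable.mul
        (hI₁.add hI₂).aestronglyMeasurable
    · rw [norm_mul]
      refine mul_le_of_le_one_left (norm_nonneg _) ?_
      rw [lineCutoff, Real.norm_of_nonneg (Real.smoothTransition.nonneg _)]
      exact Real.smoothTransition.le_one _
    · filter_upwards [ae_restrict_of_ae (ae_lineForm_pos hn hv)] with y hy
      simpa using (lineCutoff_tendsto_one hy).mul_const _
  simp only [hzero] at hlim
  exact tendsto_nhds_unique hlim tendsto_const_nhds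

section Mollify

variable {n : ℕ} {F : Type*} [NormedAddCommGroup F] [NormedSpace ℝ F]

/-- The convolution of `f` with a normalized bump function. -/
def mollify (φ : ContDiffBump (0 : Euc n)) (f : Euc n → F) (x : Euc n) : F :=
  ∫ y, φ.normed volume (x - y) • f y

lemma mollify_eq_convolution (φ : ContDiffBump (0 : Euc n)) (f : Euc n → F) :
    mollify φ f = convolution (φ.normed volume) f (ContinuousLinearMap.lsmul ℝ ℝ) volume := by
  ext x
  rw [convolution_eq_swap]
  rfl

lemma contDiff_mollify (φ : ContDiffBump (0 : Euc n)) {f : Euc n → F} (hf : Integrable f)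
    {m : ℕ∞} : ContDiff ℝ m (mollify φ f) := by
  rw [mollify_eq_convolution]
  exact φ.hasCompactSupport_normed.contDiff_convolution_left _ φ.contDiff_normed
    hf.locallyIntegrable

lemma normed_eq_zero_of_le_norm (φ : ContDiffBump (0 : Euc n)) {x : Euc n} (hx : φ.rOut ≤ ‖x‖) :
    φ.normed volume x = 0 := by
  by_contra h
  have h1 : x ∈ Function.support (φ.normed volume) := h
  rw [φ.support_normed_eq, mem_ball_zero_iff] at h1
  exact h1.not_ge hx

lemma integrable_normed_sub_smul (φ : ContDiffBump (0 : Euc n)) {f : Euc n → F}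
    (hf : Integrable f) (x : Euc n) : Integrable fun y => φ.normed volume (x - y) • f y := by
  obtain ⟨C, hC⟩ := (φ.hasCompactSupport_normed (μ := volume)).exists_bound_of_continuous
    φ.continuous_normed
  exact hf.bdd_smul C (φ.continuous_normed.comp
    (continuous_const.sub continuous_id)).aestronglyMeasurable (Eventually.of_forall fun y => hC _)

lemma integral_normed_sub (φ : ContDiffBump (0 : Euc n)) (x : Euc n) :
    ∫ y, φ.normed volume (x - y) = 1 := by
  rw [integral_sub_left_eq_self (φ.normed volume) volume x, φ.integral_normed]

lemma mollify_congr (φ : ContDiffBump (0 : Euc n)) {f g : Euc n → F} {x : Euc n}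
    (h : ∀ y, ‖x - y‖ < φ.rOut → f y = g y) : mollify φ f x = mollify φ g x := by
  refine integral_congr_ae (Eventually.of_forall fun y => ?_)
  by_cases hy : ‖x - y‖ < φ.rOut
  · simp [h y hy]
  · simp [normed_eq_zero_of_le_norm φ (not_lt.1 hy)]

lemma mollify_mono (φ : ContDiffBump (0 : Euc n)) {f g : Euc n → ℝ} (hf : Integrable f)
    (hg : Integrable g) {x : Euc n} (h : ∀ y, ‖x - y‖ < φ.rOut → f y ≤ g y) :
    mollify φ f x ≤ mollify φ g x := by
  refine integral_mono (integrable_normed_sub_smul φ hf x) (integrable_normed_sub_smul φ hg x)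
    fun y => ?_
  by_cases hy : ‖x - y‖ < φ.rOut
  · exact mul_le_mul_of_nonneg_left (h y hy) (φ.nonneg_normed _)
  · simp [normed_eq_zero_of_le_norm φ (not_lt.1 hy)]

lemma mollify_le_of_le (φ : ContDiffBump (0 : Euc n)) {f : Euc n → ℝ} (hf : Integrable f)
    {x : Euc n} {c : ℝ} (h : ∀ y, ‖x - y‖ < φ.rOut → f y ≤ c) : mollify φ f x ≤ c := by
  have h1 : ∫ y, φ.normed volume (x - y) * c = c := by
    rw [integral_mul_const, integral_normed_sub, one_mul]
  rw [← h1]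
  refine integral_mono (integrable_normed_sub_smul φ hf x)
    ((φ.integrable_normed.comp_sub_left x).mul_const c) fun y => ?_
  by_cases hy : ‖x - y‖ < φ.rOut
  · exact mul_le_mul_of_nonneg_left (h y hy) (φ.nonneg_normed _)
  · simp [normed_eq_zero_of_le_norm φ (not_lt.1 hy)]

lemma mollify_nonneg (φ : ContDiffBump (0 : Euc n)) {f : Euc n → ℝ} (hf : ∀ y, 0 ≤ f y)
    (x : Euc n) : 0 ≤ mollify φ f x :=
  integral_nonneg fun y => mul_nonneg (φ.nonneg_normed _) (hf y)

lemma gradient_mollify_of_weak (φ : ContDiffBump (0 : Euc n)) {f : Euc n → ℝ} {W : Euc n → Euc n}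
    (hf : Integrable f) (hW : Integrable W) {x : Euc n}
    (h : ∀ v, ∫ y, f y * fderiv ℝ (fun y => φ.normed volume (x - y)) y v
      = - ∫ y, ⟪W y, v⟫ * φ.normed volume (x - y)) :
    gradient (mollify φ f) x = mollify φ W x := by
  have hk : ContDiff ℝ 1 (φ.normed volume) := φ.contDiff_normed (n := 1)
  have hkc : HasCompactSupport (φ.normed volume) := φ.hasCompactSupport_normed
  refine ext_inner_right ℝ fun v => ?_
  have h1 := hkc.hasFDerivAt_convolution_left (ContinuousLinearMap.lsmul ℝ ℝ) hk
    (hf.locallyIntegrable) x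
  rw [← mollify_eq_convolution] at h1
  have hk' : Continuous (fderiv ℝ (φ.normed volume)) := hk.continuous_fderiv one_ne_zero
  obtain ⟨C, hC⟩ := (hkc.fderiv ℝ).exists_bound_of_continuous hk'
  have h2 : ∀ y, fderiv ℝ (fun y => φ.normed volume (x - y)) y v
      = - fderiv ℝ (φ.normed volume) (x - y) v := fun y => by
    have := ((hk.differentiable one_ne_zero (x - y)).hasFDerivAt).comp y
      ((hasFDerivAt_id y).const_sub x)
    have h' : HasFDerivAt (fun y => φ.normed volume (x - y)) _ y := this
    rw [h'.fderiv]
    simp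
  have hL : ∀ y, ((ContinuousLinearMap.lsmul ℝ ℝ).precompL (Euc n)
      (fderiv ℝ (φ.normed volume) (x - y))) (f y) = f y • fderiv ℝ (φ.normed volume) (x - y) := by
    intro y
    ext z
    simp [ContinuousLinearMap.precompL_apply, mul_comm]
  have hint : Integrable fun y => f y • fderiv ℝ (φ.normed volume) (x - y) := by
    have hm : AEStronglyMeasurable (fun y => fderiv ℝ (φ.normed volume) (x - y)) volume :=
      (hk'.comp (continuous_const.sub continuous_id)).aestronglyMeasurable
    exact hf.smul_bdd C hm (Eventually.of_forall fun y => hC _)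
  have h3 := h v
  simp only [h2, mul_neg, integral_neg, neg_inj] at h3
  rw [inner_gradient_left, h1.fderiv, convolution_eq_swap]
  simp only [hL]
  rw [ContinuousLinearMap.integral_apply hint, mollify, real_inner_comm,
    ← integral_inner (integrable_normed_sub_smul φ hW x)]
  simp only [real_inner_smul_right, _root_.smul_apply, smul_eq_mul, h3,
    real_inner_comm v, mul_comm]

lemma integral_inner_mollify {F : Type*} [NormedAddCommGroup F] [InnerProductSpace ℝ F]
    [CompleteSpace F]
    (φ : ContDiffBump (0 : Euc n)) {f w : Euc n → F} (hf : Integrable f) (hw : Integrable w) :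
    ∫ y, ⟪f y, mollify φ w y⟫ = ∫ x, ⟪mollify φ f x, w x⟫ := by
  obtain ⟨C, hC⟩ := (φ.hasCompactSupport_normed (μ := volume)).exists_bound_of_continuous
    φ.continuous_normed
  have hp : Integrable (Function.uncurry fun y x => φ.normed volume (y - x) * ⟪f y, w x⟫)
      (volume.prod volume) := by
    have h1 : Integrable (fun z : Euc n × Euc n => ⟪f z.1, w z.2⟫) (volume.prod volume) := by
      refine (hf.norm.mul_prod hw.norm).mono' ?_ (Eventually.of_forall fun z => ?_)
      · exact hf.aestronglyMeasurable.comp_fst.inner hw.aestronglyMeasurable.comp_snd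
      · exact norm_inner_le_norm _ _
    exact h1.bdd_mul (c := C) (φ.continuous_normed.comp
      (continuous_fst.sub continuous_snd)).aestronglyMeasurable
      (Eventually.of_forall fun z => hC _)
  calc ∫ y, ⟪f y, mollify φ w y⟫
      = ∫ y, ∫ x, φ.normed volume (y - x) * ⟪f y, w x⟫ := by
        refine integral_congr_ae (Eventually.of_forall fun y => ?_)
        simp only [mollify]
        rw [← integral_inner (integrable_normed_sub_smul φ hw y)]
        simp only [real_inner_smul_right]
    _ = ∫ x, ∫ y, φ.normed volume (y - x) * ⟪f y, w x⟫ := integral_integral_swap hp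
    _ = _ := by
        refine integral_congr_ae (Eventually.of_forall fun x => ?_)
        simp only [mollify]
        rw [real_inner_comm, ← integral_inner (integrable_normed_sub_smul φ hf x)]
        refine integral_congr_ae (Eventually.of_forall fun y => ?_)
        simp only [real_inner_smul_right, real_inner_comm (w x)]
        rw [← φ.normed_neg, neg_sub]

end Mollify

/-- A vector field with nonpositive divergence satisfies the weak form of that inequality against
nonnegative compactly supported `C¹` functions. -/
lemma integral_inner_gradient_nonneg {n : ℕ} {U : Set (Euc n)} (hU : IsOpen U) {B : Euc n → Euc n}
    (hB : ContDiffOn ℝ 1 B U) (hdiv : ∀ x ∈ U, divg B x ≤ 0) {f : Euc n → ℝ}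
    (hf : ContDiff ℝ 1 f) (hc : HasCompactSupport f) (hs : tsupport f ⊆ U) (h0 : ∀ x, 0 ≤ f x) :
    0 ≤ ∫ x, ⟪B x, gradient f x⟫ := by
  by_cases hint : Integrable fun x => ⟪B x, gradient f x⟫
  swap
  · exact (integral_undef hint).ge
  set e : Fin n → Euc n := fun i => EuclideanSpace.single i 1
  set w : Fin n → Euc n → ℝ := fun i x => f x * ⟪B x, e i⟫ with hw
  have hBx : ∀ x ∈ U, ContDiffAt ℝ 1 B x := fun x hx => hB.contDiffAt (hU.mem_nhds hx)
  have hsup : ∀ i, tsupport (w i) ⊆ tsupport f := fun i => closure_mono fun x hx => by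
    simp only [hw, Function.mem_support, ne_eq, mul_eq_zero, not_or] at hx
    exact hx.1
  have hwC : ∀ i, ContDiff ℝ 1 (w i) := fun i => contDiff_of_forall_mem_tsupport fun x hx =>
    hf.contDiffAt.mul ((hBx x (hs (hsup i hx))).inner ℝ contDiffAt_const)
  have hwc : ∀ i, HasCompactSupport (w i) := fun i =>
    hc.of_isClosed_subset (isClosed_tsupport _) (hsup i)
  have hwint : ∀ i, Integrable fun x => fderiv ℝ (w i) x (e i) := fun i =>
    (((hwC i).continuous_fderiv one_ne_zero).clm_apply
      continuous_const).integrable_of_hasCompactSupport ((hwc i).fderiv_apply ℝ (e i))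
  have hsum : ∫ x, ∑ i, fderiv ℝ (w i) x (e i) = 0 := by
    rw [integral_finsetSum _ fun i _ => hwint i]
    exact Finset.sum_eq_zero fun i _ => integral_fderiv_apply_eq_zero (hwC i) (hwc i) _
  rw [← hsum]
  refine integral_mono (integrable_finsetSum _ fun i _ => hwint i) hint fun x => ?_
  by_cases hx : x ∈ tsupport f
  · have hxU := hs hx
    have h1 : ∀ i, fderiv ℝ (w i) x (e i) =
        f x * ⟪fderiv ℝ B x (e i), e i⟫ + ⟪B x, e i⟫ * ⟪e i, gradient f x⟫ := by
      intro i
      have h2 := (hf.differentiable one_ne_zero x).hasFDerivAt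
      have h3 := ((hBx x hxU).differentiableAt one_ne_zero).hasFDerivAt
      have h4 : HasFDerivAt (w i) _ x := h2.mul (h3.inner ℝ (hasFDerivAt_const (e i) x))
      rw [h4.fderiv, inner_gradient_right]
      simp
    have h5 : ∑ i, ⟪B x, e i⟫ * ⟪e i, gradient f x⟫ = ⟪B x, gradient f x⟫ := by
      have := (EuclideanSpace.basisFun (Fin n) ℝ).sum_inner_mul_inner (B x) (gradient f x)
      simpa [EuclideanSpace.basisFun_apply] using this
    simp only [h1, Finset.sum_add_distrib, ← Finset.mul_sum, h5]
    have := mul_nonpos_of_nonneg_of_nonpos (h0 x) (hdiv x hxU)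
    unfold divg at this
    linarith
  · have h1 : ∀ i, fderiv ℝ (w i) x = 0 := fun i =>
      image_eq_zero_of_notMem_tsupport fun h => hx (hsup i (tsupport_fderiv_subset ℝ h))
    simp [h1, gradient_eq_zero_of_notMem_tsupport hx]

lemma exists_antideriv_nonneg {h : ℝ → ℝ} {s : ℝ} (hh : Continuous h) (h0 : ∀ t, 0 ≤ h t)
    (hs : ∀ t ≤ s, h t = 0) :
    ∃ F : ℝ → ℝ, (∀ t, HasDerivAt F (h t) t) ∧ (∀ t, 0 ≤ F t) ∧ ∀ t ≤ s, F t = 0 := by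
  have hF : ∀ t ≤ s, ∫ τ in s..t, h τ = 0 := fun t ht => by
    rw [intervalIntegral.integral_symm, intervalIntegral.integral_congr (g := fun _ => 0)]
    · simp
    · intro τ hτ
      rw [uIcc_of_le ht] at hτ
      exact hs τ hτ.2
  refine ⟨fun t => ∫ τ in s..t, h τ, fun t => hh.integral_hasStrictDerivAt s t |>.hasDerivAt,
    fun t => ?_, hF⟩
  rcases le_total t s with ht | ht
  · exact (hF t ht).ge
  · exact intervalIntegral.integral_nonneg ht fun τ _ => h0 τ

lemma gradient_comp {n : ℕ} {h : ℝ → ℝ} {h' : ℝ} {G : Euc n → ℝ} {x : Euc n}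
    (hh : HasDerivAt h h' (G x)) (hG : DifferentiableAt ℝ G x) :
    gradient (fun y => h (G y)) x = h' • gradient G x := by
  have := hh.comp_hasFDerivAt x hG.hasFDerivAt
  have h' : HasFDerivAt (fun y => h (G y)) _ x := this
  rw [gradient, h'.fderiv, map_smul, gradient]

lemma tsupport_comp_subset_closedBall {n : ℕ} {h : ℝ → ℝ} {s ρ : ℝ} {G : Euc n → ℝ}
    (hs : ∀ t ≤ s, h t = 0) (hG : ∀ x, ρ ≤ ‖x‖ → G x ≤ s) :
    tsupport (fun y => h (G y)) ⊆ closedBall 0 ρ := by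
  refine closure_minimal (fun x hx => ?_) isClosed_closedBall
  rw [mem_closedBall_zero_iff]
  by_contra hlt
  exact hx (hs _ (hG x (not_le.1 hlt).le))

lemma tsupport_normed_sub_subset {n : ℕ} (φ : ContDiffBump (0 : Euc n)) (x : Euc n) :
    tsupport (fun y => φ.normed volume (x - y)) ⊆ closedBall x φ.rOut := by
  refine closure_minimal (fun y hy => ?_) isClosed_closedBall
  rw [mem_closedBall, dist_comm, dist_eq_norm]
  by_contra hlt
  exact hy (normed_eq_zero_of_le_norm φ (not_le.1 hlt).le)

/-- Mollification commutes with the gradient for a function with an isolated singularity, away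
from the boundary of the domain. -/
lemma gradient_mollify_indicator {n : ℕ} (hn : 2 ≤ n) {U : Set (Euc n)} (hU : IsOpen U)
    {g : Euc n → ℝ} (hg : ContDiffOn ℝ 1 g (U \ {0})) (hgi : IntegrableOn g U)
    (hdi : IntegrableOn (fun x => ‖gradient g x‖) U) (φ : ContDiffBump (0 : Euc n)) {x : Euc n}
    (hx : closedBall x φ.rOut ⊆ U) :
    gradient (mollify φ (U.indicator g)) x = mollify φ (U.indicator (gradient g)) x := by
  refine gradient_mollify_of_weak φ ((integrable_indicator_iff hU.measurableSet).2 hgi)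
    ((integrable_indicator_iff hU.measurableSet).2 (integrableOn_gradient hn hU hg hdi))
    fun v => ?_
  have hsup := tsupport_normed_sub_subset φ x
  have h := setIntegral_mul_fderiv_eq_neg hn hU hg hgi hdi
    (ψ := fun y => φ.normed volume (x - y))
    ((φ.contDiff_normed (n := 1)).comp (contDiff_const.sub contDiff_id))
    ((isCompact_closedBall x φ.rOut).of_isClosed_subset (isClosed_tsupport _) hsup)
    (hsup.trans hx) v
  rw [← integral_indicator hU.measurableSet, ← integral_indicator hU.measurableSet] at h
  have e₁ : (fun y => U.indicator g y * fderiv ℝ (fun y => φ.normed volume (x - y)) y v) =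
      U.indicator (fun y => g y * fderiv ℝ (fun y => φ.normed volume (x - y)) y v) :=
    funext fun y => (indicator_mul_left U g
      fun y => fderiv ℝ (fun y => φ.normed volume (x - y)) y v).symm
  have e₂ : (fun y => ⟪U.indicator (gradient g) y, v⟫ * φ.normed volume (x - y)) =
      U.indicator (fun y => ⟪gradient g y, v⟫ * φ.normed volume (x - y)) := by
    funext y
    by_cases hy : y ∈ U <;> simp [hy]
  rw [e₁, e₂]
  exact h

lemma gradient_mollify {n : ℕ} (hn : 2 ≤ n) {u : Euc n → ℝ} (hu : ContDiff ℝ 1 u)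
    (hc : HasCompactSupport u) (φ : ContDiffBump (0 : Euc n)) (x : Euc n) :
    gradient (mollify φ u) x = mollify φ (gradient u) x := by
  have hgc : HasCompactSupport (gradient u) := hc.mono' fun y hy => by
    by_contra h
    exact hy (gradient_eq_zero_of_notMem_tsupport h)
  have h := gradient_mollify_indicator hn isOpen_univ (g := u) hu.contDiffOn
    (hu.continuous.integrable_of_hasCompactSupport hc).integrableOn
    ((continuous_gradient hu).norm.integrable_of_hasCompactSupport hgc.norm).integrableOn φ
    (subset_univ (closedBall x φ.rOut))
  simpa using h

lemma tsupport_mollify_subset {n : ℕ} {ρ : ℝ} {u : Euc n → ℝ} (φ : ContDiffBump (0 : Euc n))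
    (hu : tsupport u ⊆ closedBall 0 ρ) : tsupport (mollify φ u) ⊆ closedBall 0 (ρ + φ.rOut) := by
  refine closure_minimal (fun x hx => ?_) isClosed_closedBall
  rw [mem_closedBall_zero_iff]
  by_contra hlt
  refine hx ((mollify_congr φ (g := fun _ => 0) fun y hy => ?_).trans (by simp [mollify]))
  refine image_eq_zero_of_notMem_tsupport fun h => ?_
  have h1 := mem_closedBall_zero_iff.1 (hu h)
  have h2 := norm_sub_norm_le x y
  linarith

/-- The energy estimate for the mollified Green's function, up to the commutator error `ω`. -/
lemma energy_mollify_le {n : ℕ} (hn : 2 ≤ n) {B : Euc n → Euc n} {g : Euc n → ℝ}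
    (hB : ContDiffOn ℝ 1 B (ball 0 1)) (hdiv : ∀ x ∈ ball (0 : Euc n) 1, divg B x ≤ 0)
    (hg : IsGreenPole B 0 g) {s ρ ω : ℝ} (hs : 0 < s) (φ : ContDiffBump (0 : Euc n))
    (hρ : ρ + 2 * φ.rOut < 1) (hgs : ∀ x ∈ ball (0 : Euc n) 1, ρ < ‖x‖ → g x ≤ s)
    (hω : ∀ x ∈ closedBall (0 : Euc n) (ρ + 2 * φ.rOut), ∀ y ∈ closedBall 0 (ρ + 2 * φ.rOut),
      ‖x - y‖ < φ.rOut → ‖B x - B y‖ ≤ ω) (hω0 : 0 ≤ ω)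
    {h : ℝ → ℝ} (hh : ContDiff ℝ (⊤ : ℕ∞) h) (h0 : ∀ t, 0 ≤ h t) (h1 : ∀ t, h t ≤ 1)
    (hhs : ∀ t ≤ s, h t = 0) :
    let G := mollify φ ((ball 0 1).indicator g)
    HasCompactSupport (fun x => h (G x)) ∧
    Integrable (fun x => deriv h (G x) * ‖gradient G x‖ ^ 2) ∧
    ∫ x, deriv h (G x) * ‖gradient G x‖ ^ 2 ≤
      1 + ω * ∫ x in ball 0 1, ‖gradient g x‖ := by
  intro G
  obtain ⟨-, hg3, hgi, hdi, -, hweak⟩ := hg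
  have hg1 : ContDiffOn ℝ 1 g (ball 0 1 \ {0}) := hg3.of_le (by norm_num)
  have hr := φ.rOut_pos
  set r := φ.rOut with hrdef
  set R := ρ + 2 * r with hR
  have hgI : Integrable ((ball (0 : Euc n) 1).indicator g) :=
    (integrable_indicator_iff measurableSet_ball).2 hgi
  set V : Euc n → Euc n := (ball 0 1).indicator (gradient g) with hV
  have hVI : Integrable V := (integrable_indicator_iff measurableSet_ball).2
    (integrableOn_gradient hn isOpen_ball hg1 hdi)
  have hGC : ContDiff ℝ (⊤ : ℕ∞) G := contDiff_mollify φ hgI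
  have hGC1 : ContDiff ℝ 1 G := hGC.of_le (by exact_mod_cast le_top)
  have hGs : ∀ x, ρ + r ≤ ‖x‖ → G x ≤ s := fun x hx => by
    refine mollify_le_of_le φ hgI fun y hy => ?_
    by_cases hyb : y ∈ ball (0 : Euc n) 1
    · rw [indicator_of_mem hyb]
      exact hgs y hyb (by have := norm_sub_norm_le x y; linarith)
    · rw [indicator_of_notMem hyb]
      exact hs.le
  have hGV : ∀ x, ‖x‖ ≤ ρ + r → gradient G x = mollify φ V x := fun x hx => by
    refine gradient_mollify_indicator hn isOpen_ball hg1 hgi hdi φ fun y hy => ?_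
    rw [mem_ball_zero_iff]
    have h2 := norm_sub_norm_le y x
    rw [mem_closedBall, dist_eq_norm] at hy
    linarith
  have hKball : closedBall (0 : Euc n) R ⊆ ball 0 1 := closedBall_subset_ball hρ
  -- the test function before mollification
  set u : Euc n → ℝ := fun x => h (G x) with hu
  have huC : ContDiff ℝ (⊤ : ℕ∞) u := hh.comp hGC
  have huC1 : ContDiff ℝ 1 u := huC.of_le (by exact_mod_cast le_top)
  have husup : tsupport u ⊆ closedBall 0 (ρ + r) := tsupport_comp_subset_closedBall hhs hGs
  have huc : HasCompactSupport u :=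
    (isCompact_closedBall _ _).of_isClosed_subset (isClosed_tsupport _) husup
  have huI : Integrable u := huC1.continuous.integrable_of_hasCompactSupport huc
  have hu0 : ∀ x, ρ + r < ‖x‖ → u x = 0 := fun x hx => hhs _ (hGs x hx.le)
  have hgugc : HasCompactSupport (gradient u) := huc.mono' fun y hy => by
    by_contra h
    exact hy (gradient_eq_zero_of_notMem_tsupport h)
  have hguI : Integrable (gradient u) :=
    (continuous_gradient huC1).integrable_of_hasCompactSupport hgugc
  have hh' : ∀ t, HasDerivAt h (deriv h t) t := fun t =>
    (hh.differentiable (by simp) t).hasDerivAt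
  have hgradu : ∀ x, gradient u x = deriv h (G x) • gradient G x := fun x =>
    gradient_comp (hh' _) (hGC1.differentiable one_ne_zero x)
  have hdh : ∀ t ≤ s, deriv h t = 0 := fun t ht =>
    IsLocalMin.deriv_eq_zero (Eventually.of_forall fun τ => by rw [hhs t ht]; exact h0 τ)
  -- the mollified test function
  set ψ := mollify φ u
  have hψC : ContDiff ℝ (⊤ : ℕ∞) ψ := contDiff_mollify φ huI
  have hψC1 : ContDiff ℝ 1 ψ := hψC.of_le (by exact_mod_cast le_top)
  have hψsup : tsupport ψ ⊆ closedBall 0 R :=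
    (tsupport_mollify_subset φ husup).trans (closedBall_subset_closedBall (by linarith))
  have hψc : HasCompactSupport ψ :=
    (isCompact_closedBall _ _).of_isClosed_subset (isClosed_tsupport _) hψsup
  have hψ0 : ∀ x, 0 ≤ ψ x := mollify_nonneg φ fun y => h0 _
  have hψ1 : ∀ x, ψ x ≤ 1 := fun x => mollify_le_of_le φ huI fun y _ => h1 _
  have hψgrad : ∀ x, gradient ψ x = mollify φ (gradient u) x := gradient_mollify hn huC1 huc φ
  -- the truncated drift
  set B' : Euc n → Euc n := (closedBall 0 R).indicator B with hB'
  have hBcont : ContinuousOn B (closedBall 0 R) := hB.continuousOn.mono hKball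
  have hB'm : AEStronglyMeasurable B' volume :=
    (aestronglyMeasurable_indicator_iff measurableSet_closedBall).2
      (hBcont.aestronglyMeasurable measurableSet_closedBall)
  obtain ⟨C, hC⟩ := (isCompact_closedBall (0 : Euc n) R).exists_bound_of_continuousOn hBcont
  have hB'C : ∀ x, ‖B' x‖ ≤ max C 0 := fun x => by
    by_cases hx : x ∈ closedBall (0 : Euc n) R
    · rw [hB', indicator_of_mem hx]; exact (hC x hx).trans (le_max_left _ _)
    · rw [hB', indicator_of_notMem hx, norm_zero]; exact le_max_right _ _
  set b : Euc n → ℝ := fun x => ⟪B' x, V x⟫ with hb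
  have hbI : Integrable b := by
    refine (hVI.norm.const_mul (max C 0)).mono' (hB'm.inner hVI.aestronglyMeasurable)
      (Eventually.of_forall fun x => (norm_inner_le_norm _ _).trans ?_)
    exact mul_le_mul_of_nonneg_right (hB'C x) (norm_nonneg _)
  have hI₁ : Integrable fun x => ⟪V x, gradient ψ x⟫ := by
    have hc : HasCompactSupport (gradient ψ) := hψc.mono' fun y hy => by
      by_contra h
      exact hy (gradient_eq_zero_of_notMem_tsupport h)
    obtain ⟨D, hD⟩ := hc.exists_bound_of_continuous (continuous_gradient hψC1)
    refine (hVI.norm.mul_const D).mono' (hVI.aestronglyMeasurable.inner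
      (continuous_gradient hψC1).aestronglyMeasurable)
      (Eventually.of_forall fun x => (norm_inner_le_norm _ _).trans ?_)
    exact mul_le_mul_of_nonneg_left (hD x) (norm_nonneg _)
  have hI₂ : Integrable fun x => b x * ψ x :=
    hbI.mul_bdd (c := 1) hψC1.continuous.aestronglyMeasurable
      (Eventually.of_forall fun x => by rw [Real.norm_of_nonneg (hψ0 x)]; exact hψ1 x)
  have hid : (∫ x, ⟪V x, gradient ψ x⟫) + ∫ x, b x * ψ x = ψ 0 := by
    rw [← integral_add hI₁ hI₂, ← hweak ψ hψC hψc (hψsup.trans hKball),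
      ← integral_indicator measurableSet_ball]
    refine integral_congr_ae (Eventually.of_forall fun x => ?_)
    by_cases hx : x ∈ ball (0 : Euc n) 1
    · by_cases hxK : x ∈ closedBall (0 : Euc n) R
      · simp [hb, hV, hB', indicator_of_mem hx, indicator_of_mem hxK]
      · have : ψ x = 0 := image_eq_zero_of_notMem_tsupport fun h => hxK (hψsup h)
        simp [hV, indicator_of_mem hx, this]
    · simp [hb, hV, indicator_of_notMem hx]
  have hterm₁ : ∀ x, ⟪mollify φ V x, gradient u x⟫ = deriv h (G x) * ‖gradient G x‖ ^ 2 := by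
    intro x
    rw [hgradu, real_inner_smul_right]
    rcases le_total ‖x‖ (ρ + r) with hx | hx
    · rw [← hGV x hx, real_inner_self_eq_norm_sq]
    · rw [hdh _ (hGs x hx), zero_mul, zero_mul]
  have hVmol : Continuous (mollify φ V) := (contDiff_mollify φ hVI (m := 0)).continuous
  have hbmol : Continuous (mollify φ b) := (contDiff_mollify φ hbI (m := 0)).continuous
  have hNmol : Continuous (mollify φ fun x => ‖V x‖) :=
    (contDiff_mollify φ hVI.norm (m := 0)).continuous
  have hsw₁ : ∫ x, ⟪V x, gradient ψ x⟫ = ∫ x, deriv h (G x) * ‖gradient G x‖ ^ 2 := by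
    simp only [hψgrad, ← hterm₁]
    exact integral_inner_mollify φ hVI hguI
  have hsw : ∀ {f : Euc n → ℝ}, Integrable f → ∫ x, f x * ψ x = ∫ x, mollify φ f x * u x := by
    intro f hf
    have := integral_inner_mollify φ hf huI
    simpa [mul_comm] using this
  have hIe : Integrable fun x => deriv h (G x) * ‖gradient G x‖ ^ 2 := by
    simp only [← hterm₁]
    refine (hVmol.inner (continuous_gradient huC1)).integrable_of_hasCompactSupport
      (hgugc.mono fun x hx => ?_)
    exact fun h => hx (by simp only [h, inner_zero_right])
  refine ⟨huc, hIe, ?_⟩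
  -- the drift term against the mollified gradient is nonnegative
  have hdrift : 0 ≤ ∫ x, ⟪B x, gradient G x⟫ * u x := by
    obtain ⟨F, hF, hF0, hFs⟩ := exists_antideriv_nonneg hh.continuous h0 hhs
    have hFC : ContDiff ℝ 1 F := by
      refine contDiff_one_iff_deriv.2 ⟨fun t => (hF t).differentiableAt, ?_⟩
      rw [show deriv F = h from funext fun t => (hF t).deriv]
      exact hh.continuous
    have hsub : tsupport (fun x => F (G x)) ⊆ closedBall 0 (ρ + r) :=
      tsupport_comp_subset_closedBall hFs hGs
    have := integral_inner_gradient_nonneg isOpen_ball hB hdiv (hFC.comp hGC1)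
      ((isCompact_closedBall _ _).of_isClosed_subset (isClosed_tsupport _) hsub)
      (hsub.trans (closedBall_subset_ball (by linarith))) (fun x => hF0 _)
    refine this.trans_eq (integral_congr_ae (Eventually.of_forall fun x => ?_))
    have h2 := gradient_comp (hF (G x)) (hGC1.differentiable one_ne_zero x)
    simp only [Function.comp_def, h2, real_inner_smul_right, hu, mul_comm]
  have hI₃ : Integrable fun x => ⟪B x, gradient G x⟫ * u x := by
    have hw : ContDiff ℝ 1 fun x => u x • B x := contDiff_of_forall_mem_tsupport fun x hx => by
      have hx' : x ∈ tsupport u := closure_mono (Function.support_smul_subset_left u B) hx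
      exact huC1.contDiffAt.smul (hB.contDiffAt (isOpen_ball.mem_nhds
        (closedBall_subset_ball (by linarith) (husup hx'))))
    have hcont := hw.continuous.inner (continuous_gradient hGC1) (𝕜 := ℝ)
    simp only [real_inner_smul_left, mul_comm (u _)] at hcont
    exact hcont.integrable_of_hasCompactSupport huc.mul_left
  have hI₄ : Integrable fun x => mollify φ b x * u x :=
    (hbmol.mul huC1.continuous).integrable_of_hasCompactSupport huc.mul_left
  have hI₅ : Integrable fun x => mollify φ (fun y => ‖V y‖) x * u x :=
    (hNmol.mul huC1.continuous).integrable_of_hasCompactSupport huc.mul_left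
  have hcomm : ∀ x, ‖x‖ ≤ ρ + r →
      ⟪B x, gradient G x⟫ - ω * mollify φ (fun y => ‖V y‖) x ≤ mollify φ b x := by
    intro x hx
    have hlin : mollify φ (fun y => ⟪B x, V y⟫ - ω * ‖V y‖) x =
        ⟪B x, gradient G x⟫ - ω * mollify φ (fun y => ‖V y‖) x := by
      rw [hGV x hx]
      simp only [mollify]
      rw [← integral_inner (integrable_normed_sub_smul φ hVI x), ← integral_const_mul,
        ← integral_sub ((integrable_normed_sub_smul φ hVI x).const_inner _)
          ((integrable_normed_sub_smul φ hVI.norm x).const_mul ω)]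
      refine integral_congr_ae (Eventually.of_forall fun y => ?_)
      simp only [real_inner_smul_right, smul_eq_mul]
      ring
    rw [← hlin]
    refine mollify_mono φ ((hVI.const_inner _).sub (hVI.norm.const_mul ω)) hbI fun y hy => ?_
    have hxK : x ∈ closedBall (0 : Euc n) R := mem_closedBall_zero_iff.2 (by linarith)
    have hyK : y ∈ closedBall (0 : Euc n) R := mem_closedBall_zero_iff.2 (by
      have := norm_sub_norm_le y x
      rw [norm_sub_rev] at this
      linarith)
    have h2 : ⟪B x - B y, V y⟫ ≤ ω * ‖V y‖ := (real_inner_le_norm _ _).trans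
      (mul_le_mul_of_nonneg_right (hω x hxK y hyK hy) (norm_nonneg _))
    simp only [hb, hB', indicator_of_mem hyK]
    rw [inner_sub_left] at h2
    change ⟪B x, V y⟫ - ω * ‖V y‖ ≤ ⟪B y, V y⟫
    linarith
  have hlow : (∫ x, ⟪B x, gradient G x⟫ * u x) - ω * ∫ x, mollify φ (fun y => ‖V y‖) x * u x ≤
      ∫ x, mollify φ b x * u x := by
    rw [← integral_const_mul, ← integral_sub hI₃ (hI₅.const_mul ω)]
    refine integral_mono (hI₃.sub (hI₅.const_mul ω)) hI₄ fun x => ?_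
    rcases le_or_gt ‖x‖ (ρ + r) with hx | hx
    · have := mul_le_mul_of_nonneg_right (hcomm x hx) (h0 (G x))
      simp only [hu]
      linarith
    · simp [hu0 x hx]
  have hVint : ∫ x, ‖V x‖ = ∫ x in ball 0 1, ‖gradient g x‖ := by
    rw [← integral_indicator measurableSet_ball]
    simp only [hV, norm_indicator_eq_indicator_norm]
  have hmass : ∫ x, mollify φ (fun y => ‖V y‖) x * u x ≤ ∫ x in ball 0 1, ‖gradient g x‖ := by
    rw [← hVint, ← hsw hVI.norm]
    refine integral_mono (hVI.norm.mul_bdd (c := 1) hψC1.continuous.aestronglyMeasurable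
      (Eventually.of_forall fun x => by rw [Real.norm_of_nonneg (hψ0 x)]; exact hψ1 x))
      hVI.norm fun x => mul_le_of_le_one_right (norm_nonneg _) (hψ1 x)
  have hmass' := mul_le_mul_of_nonneg_left hmass hω0
  rw [hsw₁, hsw hbI] at hid
  have := hψ1 0
  linarith

lemma exists_deriv_smoothTransition_le :
    ∃ D > 0, ∀ t, deriv Real.smoothTransition t ≤ D := by
  have hc : Continuous (deriv Real.smoothTransition) :=
    (Real.smoothTransition.contDiff (n := 1)).continuous_deriv le_rfl
  obtain ⟨D, hD⟩ := isCompact_Icc.exists_bound_of_continuousOn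
    (s := Icc (0 : ℝ) 1) hc.continuousOn
  refine ⟨max D 1, by positivity, fun t => ?_⟩
  by_cases ht : t ∈ Icc (0 : ℝ) 1
  · exact (le_abs_self _).trans ((hD t ht).trans (le_max_left _ _))
  · suffices h : deriv Real.smoothTransition t = 0 by rw [h]; positivity
    rw [mem_Icc, not_and_or, not_le, not_le] at ht
    rcases ht with ht | ht
    · refine IsLocalMin.deriv_eq_zero (Eventually.of_forall fun τ => ?_)
      rw [Real.smoothTransition.zero_of_nonpos ht.le]
      exact Real.smoothTransition.nonneg τ
    · refine IsLocalMax.deriv_eq_zero (Eventually.of_forall fun τ => ?_)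
      rw [Real.smoothTransition.one_of_one_le ht.le]
      exact Real.smoothTransition.le_one τ

/-- A smooth cutoff equal to `0` on `(-∞, s]` and to `1` on `[2s, ∞)`. -/
def levelCutoff (s t : ℝ) : ℝ := Real.smoothTransition (t / s - 1)

lemma contDiff_levelCutoff (s : ℝ) {m : ℕ∞} : ContDiff ℝ m (levelCutoff s) :=
  Real.smoothTransition.contDiff.comp ((contDiff_id.div_const s).sub contDiff_const)

lemma levelCutoff_eq_zero {s t : ℝ} (hs : 0 < s) (ht : t ≤ s) : levelCutoff s t = 0 :=
  Real.smoothTransition.zero_of_nonpos (by rw [sub_nonpos, div_le_one hs]; exact ht)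

lemma levelCutoff_eq_one {s t : ℝ} (hs : 0 < s) (ht : 2 * s ≤ t) : levelCutoff s t = 1 :=
  Real.smoothTransition.one_of_one_le (by rw [le_sub_iff_add_le, le_div_iff₀ hs]; linarith)

lemma deriv_levelCutoff_nonneg {s : ℝ} (hs : 0 < s) (t : ℝ) : 0 ≤ deriv (levelCutoff s) t :=
  Monotone.deriv_nonneg fun a b hab =>
    Real.smoothTransition.monotone (by gcongr)

lemma deriv_levelCutoff_le {s D : ℝ} (hs : 0 < s)
    (hD : ∀ t, deriv Real.smoothTransition t ≤ D) (t : ℝ) : deriv (levelCutoff s) t ≤ D / s := by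
  have h1 : HasDerivAt (fun t : ℝ => t / s - 1) (1 / s) t :=
    ((hasDerivAt_id t).div_const s).sub_const 1
  have h2 : HasDerivAt Real.smoothTransition (deriv Real.smoothTransition (t / s - 1))
      (t / s - 1) :=
    ((Real.smoothTransition.contDiff (n := 1)).differentiable (by simp) _).hasDerivAt
  have h3 : deriv (levelCutoff s) t = deriv Real.smoothTransition (t / s - 1) * (1 / s) :=
    (h2.comp t h1).deriv
  rw [h3, mul_one_div]
  exact div_le_div_of_nonneg_right (hD _) hs.le

lemma eLpNorm_fderiv_two_le {n : ℕ} {u : Euc n → ℝ} (hu : ContDiff ℝ 1 u)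
    (hc : HasCompactSupport u) {a : ℝ} (ha : ∫ x, ‖gradient u x‖ ^ 2 ≤ a) :
    eLpNorm (fderiv ℝ u) 2 volume ≤ ENNReal.ofReal (√a) := by
  have hm : MemLp (fderiv ℝ u) 2 volume :=
    (hu.continuous_fderiv one_ne_zero).memLp_of_hasCompactSupport (hc.fderiv (𝕜 := ℝ))
  rw [hm.eLpNorm_eq_integral_rpow_norm two_ne_zero ENNReal.ofNat_ne_top]
  refine ENNReal.ofReal_le_ofReal ?_
  rw [Real.sqrt_eq_rpow]
  simp only [ENNReal.toReal_ofNat, one_div, Real.rpow_two, ← norm_gradient]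
  exact Real.rpow_le_rpow (by positivity) ha (by norm_num)

/-- Sobolev inequality for an almost everywhere limit, combined with Chebyshev's inequality. -/
lemma measure_rpow_le_of_tendsto {n : ℕ} (hn : 3 ≤ n) {u : ℕ → Euc n → ℝ} {f : Euc n → ℝ}
    (hu : ∀ k, ContDiff ℝ 1 (u k)) (hc : ∀ k, HasCompactSupport (u k)) {a : ℝ} (ha0 : 0 ≤ a)
    (ha : ∀ k, ∫ x, ‖gradient (u k) x‖ ^ 2 ≤ a)
    (hlim : ∀ᵐ x, Tendsto (fun k => u k x) atTop (𝓝 (f x))) {S : Set (Euc n)}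
    (hS : ∀ x ∈ S, 1 ≤ f x) :
    (volume S).toReal ^ (((n : ℝ) - 2) / n) ≤
      (eLpNormLESNormFDerivOfEqInnerConst (volume : Measure (Euc n)) 2 : ℝ) ^ 2 * a := by
  set C := eLpNormLESNormFDerivOfEqInnerConst (volume : Measure (Euc n)) 2
  have hn3 : (3 : ℝ) ≤ n := by exact_mod_cast hn
  have hn2 : (0 : ℝ) < n - 2 := by linarith
  have hn0 : (0 : ℝ) < n := by linarith
  set p : NNReal := ⟨2 * n / (n - 2), by positivity⟩
  have hpv : (p : ℝ) = 2 * n / (n - 2) := rfl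
  have hp0 : 0 < (p : ℝ) := by rw [hpv]; positivity
  have hbound : ∀ k, eLpNorm (u k) p volume ≤ ENNReal.ofReal (C * √a) := fun k => by
    refine (eLpNorm_le_eLpNorm_fderiv_of_eq_inner volume (hu k) (hc k) (p := 2) (p' := p)
      (by norm_num) (by simp; omega) ?_).trans ?_
    · rw [hpv, finrank_euclideanSpace_fin, NNReal.coe_inv, NNReal.coe_ofNat]
      field_simp
    · rw [ENNReal.ofReal_mul C.coe_nonneg, ENNReal.ofReal_coe_nnreal]
      exact mul_le_mul_right (eLpNorm_fderiv_two_le (hu k) (hc k) (ha k)) _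
  have hfm : AEStronglyMeasurable f volume :=
    aestronglyMeasurable_of_tendsto_ae atTop
      (fun k => (hu k).continuous.aestronglyMeasurable) hlim
  have hf : eLpNorm f p volume ≤ ENNReal.ofReal (C * √a) :=
    (Lp.eLpNorm_lim_le_liminf_eLpNorm (fun k => (hu k).continuous.aestronglyMeasurable) f
      hlim).trans (liminf_le_of_le (by isBoundedDefault) fun b hb => by
        obtain ⟨k, hk⟩ := hb.exists
        exact hk.trans (hbound k))
  have hch := mul_meas_ge_le_pow_eLpNorm' volume (p := p)
    (by exact_mod_cast hp0.ne') ENNReal.coe_ne_top hfm 1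
  rw [ENNReal.one_rpow, one_mul, ENNReal.coe_toReal] at hch
  have hvol : volume S ≤ ENNReal.ofReal ((C * √a) ^ (p : ℝ)) := by
    rw [← ENNReal.ofReal_rpow_of_nonneg (by positivity) hp0.le]
    refine (measure_mono fun x hx => ?_).trans
      (hch.trans (ENNReal.rpow_le_rpow hf hp0.le))
    rw [mem_ofPred_eq, ← ofReal_norm, ← ENNReal.ofReal_one]
    exact ENNReal.ofReal_le_ofReal ((hS x hx).trans (le_abs_self _))
  have hreal : (volume S).toReal ≤ (C * √a) ^ (p : ℝ) :=
    ENNReal.toReal_le_of_le_ofReal (by positivity) hvol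
  refine (Real.rpow_le_rpow ENNReal.toReal_nonneg hreal (by positivity)).trans_eq ?_
  rw [← Real.rpow_mul (by positivity), hpv,
    show 2 * (n : ℝ) / (n - 2) * ((n - 2) / n) = 2 by field_simp, Real.rpow_two, mul_pow,
    Real.sq_sqrt ha0]

/-- The gradient of the truncated mollified Green's function is controlled by `D / s`. -/
lemma integral_gradient_levelCutoff_mollify_le {n : ℕ} (hn : 2 ≤ n) {B : Euc n → Euc n}
    {g : Euc n → ℝ} (hB : ContDiffOn ℝ 1 B (ball 0 1))
    (hdiv : ∀ x ∈ ball (0 : Euc n) 1, divg B x ≤ 0) (hg : IsGreenPole B 0 g) {s D : ℝ}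
    (hs : 0 < s) (hD : ∀ t, deriv Real.smoothTransition t ≤ D) :
    ∃ δ > 0, ∀ φ : ContDiffBump (0 : Euc n), φ.rOut ≤ δ →
      ContDiff ℝ 1 (fun x => levelCutoff s (mollify φ ((ball 0 1).indicator g) x)) ∧
      HasCompactSupport (fun x => levelCutoff s (mollify φ ((ball 0 1).indicator g) x)) ∧
      ∫ x, ‖gradient (fun x => levelCutoff s (mollify φ ((ball 0 1).indicator g) x)) x‖ ^ 2 ≤
        2 * D / s := by
  obtain ⟨t, ht1, ht⟩ := hg.2.2.2.2.1 s hs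
  set ρ := max t 0
  have hρ1 : ρ < 1 := max_lt ht1 one_pos
  set I := ∫ x in ball 0 1, ‖gradient g x‖
  have hI : 0 ≤ I := integral_nonneg fun x => norm_nonneg _
  set ω := (1 + I)⁻¹ with hω
  have hω0 : 0 < ω := by positivity
  have huc : UniformContinuousOn B (closedBall 0 ((1 + ρ) / 2)) :=
    (isCompact_closedBall _ _).uniformContinuousOn_of_continuous
      (hB.continuousOn.mono (closedBall_subset_ball (by linarith)))
  obtain ⟨η, hη, hBη⟩ := Metric.uniformContinuousOn_iff.1 huc ω hω0
  refine ⟨min ((1 - ρ) / 4) η, lt_min (by linarith) hη, fun φ hφ => ?_⟩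
  have hφ1 := hφ.trans (min_le_left _ _)
  have hφ2 := hφ.trans (min_le_right _ _)
  have hsub : closedBall (0 : Euc n) (ρ + 2 * φ.rOut) ⊆ closedBall 0 ((1 + ρ) / 2) :=
    closedBall_subset_closedBall (by linarith)
  obtain ⟨hc, hint, hle⟩ := energy_mollify_le hn hB hdiv hg hs φ (ρ := ρ) (ω := ω)
    (by linarith)
    (fun x hx hxρ => (le_abs_self _).trans (ht x hx ((le_max_left _ _).trans_lt hxρ)).le)
    (fun x hx y hy hxy => by
      rw [← dist_eq_norm] at hxy ⊢
      exact (hBη x (hsub hx) y (hsub hy) (hxy.trans_le hφ2)).le)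
    hω0.le (h := levelCutoff s) (contDiff_levelCutoff s)
    (fun _ => Real.smoothTransition.nonneg _) (fun _ => Real.smoothTransition.le_one _)
    (fun _ => levelCutoff_eq_zero hs)
  set G := mollify φ ((ball 0 1).indicator g)
  have hG : ContDiff ℝ 1 G := contDiff_mollify φ
    ((integrable_indicator_iff measurableSet_ball).2 hg.2.2.1) (m := 1)
  have hcut : ContDiff ℝ 1 (levelCutoff s) := contDiff_levelCutoff s (m := 1)
  have hgrad : ∀ x, ‖gradient (fun x => levelCutoff s (G x)) x‖ ^ 2 =
      deriv (levelCutoff s) (G x) * (deriv (levelCutoff s) (G x) * ‖gradient G x‖ ^ 2) := by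
    intro x
    have h1 := gradient_comp ((hcut.differentiable one_ne_zero) (G x)).hasDerivAt
      (hG.differentiable one_ne_zero x)
    rw [h1, norm_smul, mul_pow, Real.norm_eq_abs, sq_abs]
    ring
  refine ⟨hcut.comp hG, hc, ?_⟩
  have hωI : ω * I ≤ 1 := by
    rw [hω, inv_mul_le_iff₀ (by positivity)]
    linarith
  have hD0 : 0 ≤ D / s := (deriv_levelCutoff_nonneg hs 0).trans (deriv_levelCutoff_le hs hD 0)
  calc ∫ x, ‖gradient (fun x => levelCutoff s (G x)) x‖ ^ 2
      ≤ ∫ x, D / s * (deriv (levelCutoff s) (G x) * ‖gradient G x‖ ^ 2) := by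
        refine integral_mono_of_nonneg (Eventually.of_forall fun x => sq_nonneg _)
          (hint.const_mul _) (Eventually.of_forall fun x => ?_)
        simp only [hgrad]
        exact mul_le_mul_of_nonneg_right (deriv_levelCutoff_le hs hD _)
          (mul_nonneg (deriv_levelCutoff_nonneg hs _) (sq_nonneg _))
    _ = D / s * ∫ x, deriv (levelCutoff s) (G x) * ‖gradient G x‖ ^ 2 := integral_const_mul _ _
    _ ≤ D / s * 2 := mul_le_mul_of_nonneg_left (by linarith) hD0
    _ = 2 * D / s := by ring

lemma measure_levelSet_rpow_le {n : ℕ} (hn : 3 ≤ n) {B : Euc n → Euc n} {g : Euc n → ℝ}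
    (hB : ContDiffOn ℝ 1 B (ball 0 1)) (hdiv : ∀ x ∈ ball (0 : Euc n) 1, divg B x ≤ 0)
    (hg : IsGreenPole B 0 g) {s D : ℝ} (hs : 0 < s) (hD0 : 0 < D)
    (hD : ∀ t, deriv Real.smoothTransition t ≤ D) :
    (volume (levelSet g (2 * s))).toReal ^ (((n : ℝ) - 2) / n) ≤
      (eLpNormLESNormFDerivOfEqInnerConst (volume : Measure (Euc n)) 2 : ℝ) ^ 2 *
        (2 * D / s) := by
  obtain ⟨δ, hδ, h⟩ := integral_gradient_levelCutoff_mollify_le (by omega) hB hdiv hg hs hD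
  let φ : ℕ → ContDiffBump (0 : Euc n) := fun k =>
    ⟨δ / (k + 1) / 2, δ / (k + 1), by positivity, half_lt_self (by positivity)⟩
  have hφ : ∀ k, (φ k).rOut ≤ δ := fun k =>
    div_le_self hδ.le (by have : (0 : ℝ) ≤ k := k.cast_nonneg; linarith)
  have hφ0 : Tendsto (fun k => (φ k).rOut) atTop (𝓝 0) :=
    tendsto_const_nhds.div_atTop (tendsto_atTop_add_const_right _ _ tendsto_natCast_atTop_atTop)
  have hgI : Integrable ((ball (0 : Euc n) 1).indicator g) :=
    (integrable_indicator_iff measurableSet_ball).2 hg.2.2.1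
  have hconv := ContDiffBump.ae_convolution_tendsto_right_of_locallyIntegrable (K := 2) hφ0
    (Eventually.of_forall fun k => by
      change δ / (k + 1) ≤ 2 * (δ / (k + 1) / 2)
      linarith) (hgI.locallyIntegrable)
  refine measure_rpow_le_of_tendsto hn (fun k => (h (φ k) (hφ k)).1)
    (fun k => (h (φ k) (hφ k)).2.1) (by positivity) (fun k => (h (φ k) (hφ k)).2.2)
    (f := fun x => levelCutoff s ((ball 0 1).indicator g x)) ?_ fun x hx => ?_
  · filter_upwards [hconv] with x hx
    refine ((contDiff_levelCutoff s (m := 0)).continuous.tendsto _).comp ?_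
    simpa only [mollify_eq_convolution] using hx
  · simp only [indicator_of_mem hx.1]
    exact (levelCutoff_eq_one hs hx.2.2).ge

/-- level-set decay inequality
`|Ω_{2s}|^{(n-2)/n} ≤ K₁/s + K₂ (∫_{Ω_s} |B|ⁿ)^{2/n} |Ω_s|^{(n-2)/n}`, with `K₁, K₂`
depending only on `n`. -/
theorem level_set_decay
    (n : ℕ) (hn : 3 ≤ n) :
    ∃ K₁ > (0 : ℝ), ∃ K₂ > (0 : ℝ),
      ∀ (β M : ℝ), 0 < β → β < 1 → 0 < M →
      ∀ (B : Euc n → Euc n) (g : Euc n → ℝ),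
        AdmissibleDrift β M B → IsGreenPole B (0 : Euc n) g →
        ∀ s > (0 : ℝ),
          (volume (levelSet g (2 * s))).toReal ^ (((n : ℝ) - 2) / n) ≤
            K₁ / s +
              K₂ * (∫ x in levelSet g s, ‖B x‖ ^ n) ^ ((2 : ℝ) / n) *
                (volume (levelSet g s)).toReal ^ (((n : ℝ) - 2) / n) := by
  obtain ⟨D, hD0, hD⟩ := exists_deriv_smoothTransition_le
  set C := eLpNormLESNormFDerivOfEqInnerConst (volume : Measure (Euc n)) 2
  refine ⟨(C : ℝ) ^ 2 * (2 * D) + 1, by positivity, 1, one_pos, ?_⟩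
  intro β M _ _ _ B g hB hg s hs
  have h := measure_levelSet_rpow_le hn hB.1 (fun x hx => (hB.2.2 x hx).2) hg hs hD0 hD
  have hnn : 0 ≤ 1 * (∫ x in levelSet g s, ‖B x‖ ^ n) ^ ((2 : ℝ) / n) *
      (volume (levelSet g s)).toReal ^ (((n : ℝ) - 2) / n) := by
    have : 0 ≤ ∫ x in levelSet g s, ‖B x‖ ^ n := integral_nonneg fun x => by positivity
    positivity
  refine (h.trans ?_).trans (le_add_of_nonneg_right hnn)
  rw [← mul_div_assoc]
  gcongr
  linarith
end
end
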